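/- Let (R, m) be a complete Noetherian local ring, M a finite R-module of Krull dimension n ≥ 1, and T a non-empty proper subset of Assh_R(M); write Assh_R(M) \ T = {q_1, …, q_r}. Then the following are equivalent: (i) there exists an ideal a of R with Att_R(H^n_a(M)) = T; (ii) for each i with 1 ≤ i ≤ r there exists a prime Q_i ∈ Supp_R(M) with dim(R/Q_i) = 1 such that the intersection of all primes p ∈ T is not contained in Q_i and q_i ⊆ Q_i. -/

import Mathlib

/-!
STATEMENT 1 (Dibaei–Jafari, Proposition 2.1): Let `(R, m)` be a complete Noetherian local
ring, `M` a finite `R`-module of dimension `n ≥ 1` and `T` a non-empty proper subset of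
`Assh_R(M)` with `Assh_R(M) \ T = {q_1, …, q_r}`.  Then there is an ideal `a` with
`Att_R(H^n_a(M)) = T` iff for each `q ∈ Assh_R(M) \ T` there is a prime `Q ∈ Supp_R(M)`
with `dim(R/Q) = 1`, `⋂_{p ∈ T} p ⊄ Q` and `q ⊆ Q`.
-/

open CategoryTheory

noncomputable section

universe u

/-- A prime ideal `p` is an *attached prime* of the `R`-module `N` if `p` is the annihilator
of some quotient of `N`. -/
def attachedPrimes (R : Type u) [CommRing R] (N : Type u) [AddCommGroup N] [Module R N] :
    Set (Ideal R) :=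
  { p | p.IsPrime ∧ ∃ K : Submodule R N, p = Module.annihilator R (N ⧸ K) }

/-- `Assh_R(M)`: the associated primes `p` of `M` with `dim (R ⧸ p) = dim M`, where the
dimension of `M` is recorded by the natural number `n`. -/
def assh (R : Type u) [CommRing R] (M : Type u) [AddCommGroup M] [Module R M] (n : ℕ) :
    Set (Ideal R) :=
  { p ∈ associatedPrimes R M | ringKrullDim (R ⧸ p) = (n : WithBot (WithTop ℕ)) }

namespace LCx

open Abelian

section basic
variable {R : Type u} [CommRing R]

abbrev Q (I : Ideal R) : ModuleCat.{u} R := ModuleCat.of R (R ⧸ I)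

def qmap {I J : Ideal R} (h : I ≤ J) : Q I ⟶ Q J :=
  ModuleCat.ofHom (Submodule.mapQ _ _ LinearMap.id h)

lemma qmap_comp {I J K : Ideal R} (h : I ≤ J) (h' : J ≤ K) :
    qmap h ≫ qmap h' = qmap (h.trans h') := by
  ext; rfl

lemma qmap_refl {I : Ideal R} (h : I ≤ I) : qmap h = 𝟙 _ := by
  ext; rfl

def res {I J : Ideal R} (h : I ≤ J) (M : ModuleCat.{u} R) (i : ℕ) :
    Ext (Q J) M i →ₗ[R] Ext (Q I) M i :=
  (Ext.mk₀ (qmap h)).precompOfLinear R M (zero_add i)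

lemma res_apply {I J : Ideal R} (h : I ≤ J) (M : ModuleCat.{u} R) (i : ℕ) (e : Ext (Q J) M i) :
    res h M i e = (Ext.mk₀ (qmap h)).comp e (zero_add i) := rfl

lemma res_res {I J K : Ideal R} (h : I ≤ J) (h' : J ≤ K) (M : ModuleCat.{u} R) (i : ℕ)
    (e : Ext (Q K) M i) : res h M i (res h' M i e) = res (h.trans h') M i e := by
  simp only [res_apply, Ext.mk₀_comp_mk₀_assoc, qmap_comp]

lemma res_comp {I J : Ideal R} (h : I ≤ J) {M N : ModuleCat.{u} R} {i j k : ℕ}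
    (e : Ext (Q J) M i) (β : Ext M N j) (hk : i + j = k) :
    (res h M i e).comp β hk = res h N k (e.comp β hk) := by
  simp only [res_apply]
  exact Ext.comp_assoc _ _ _ _ _ (by omega)

instance dirsys (a : Ideal R) (i : ℕ) (M : ModuleCat.{u} R) :
    DirectedSystem (fun t : ℕ => Ext (Q (a ^ t)) M i)
      (fun s t h => res (Ideal.pow_le_pow_right h) M i) where
  map_self := by
    intro t x
    simp [res_apply, qmap_refl]
  map_map := by
    intro t s r h1 h2 x
    exact res_res _ _ _ _ _

abbrev tr (a : Ideal R) (i : ℕ) (M : ModuleCat.{u} R) (s t : ℕ) (h : s ≤ t) :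
    Ext (Q (a ^ s)) M i →ₗ[R] Ext (Q (a ^ t)) M i := res (Ideal.pow_le_pow_right h) M i

def LC (a : Ideal R) (i : ℕ) (M : ModuleCat.{u} R) : Type u :=
  Module.DirectLimit (fun t : ℕ => Ext (Q (a ^ t)) M i) (tr a i M)

instance (a : Ideal R) (i : ℕ) (M : ModuleCat.{u} R) : AddCommGroup (LC a i M) :=
  inferInstanceAs (AddCommGroup (Module.DirectLimit (fun t : ℕ => Ext (Q (a ^ t)) M i) (tr a i M)))
instance (a : Ideal R) (i : ℕ) (M : ModuleCat.{u} R) : Module R (LC a i M) :=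
  inferInstanceAs (Module R (Module.DirectLimit (fun t : ℕ => Ext (Q (a ^ t)) M i) (tr a i M)))

variable (a : Ideal R) (i : ℕ) (M : ModuleCat.{u} R)

def io (t : ℕ) : Ext (Q (a ^ t)) M i →ₗ[R] LC a i M :=
  Module.DirectLimit.of R ℕ (fun t : ℕ => Ext (Q (a ^ t)) M i) (tr a i M) t

variable {a i M}
lemma io_surj (x : LC a i M) : ∃ t e, io a i M t e = x :=
  Module.DirectLimit.exists_of (G := fun t : ℕ => Ext (Q (a ^ t)) M i) (f := tr a i M) x

lemma io_res {s t : ℕ} (h : s ≤ t) (h' : a ^ t ≤ a ^ s) (e : Ext (Q (a ^ s)) M i) :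
    io a i M t (res h' M i e) = io a i M s e :=
  Module.DirectLimit.of_f (G := fun t : ℕ => Ext (Q (a ^ t)) M i) (f := tr a i M) (hij := h)

lemma io_zero {s : ℕ} (e : Ext (Q (a ^ s)) M i) (h0 : io a i M s e = 0) :
    ∃ t, ∃ h : s ≤ t, res (Ideal.pow_le_pow_right h) M i e = 0 :=
  Module.DirectLimit.of.zero_exact (G := fun t : ℕ => Ext (Q (a ^ t)) M i) (f := tr a i M) h0

def lcLift {P : Type*} [AddCommGroup P] [Module R P]
    (g : ∀ t, Ext (Q (a ^ t)) M i →ₗ[R] P)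
    (hg : ∀ s t (h : s ≤ t) e, g t (res (Ideal.pow_le_pow_right h) M i e) = g s e) :
    LC a i M →ₗ[R] P :=
  Module.DirectLimit.lift R ℕ (fun t : ℕ => Ext (Q (a ^ t)) M i) (tr a i M) g hg

lemma lcLift_io {P : Type*} [AddCommGroup P] [Module R P]
    (g : ∀ t, Ext (Q (a ^ t)) M i →ₗ[R] P)
    (hg : ∀ s t (h : s ≤ t) e, g t (res (Ideal.pow_le_pow_right h) M i e) = g s e) (t e) :
    lcLift g hg (io a i M t e) = g t e := 
  Module.DirectLimit.lift_of (G := fun t : ℕ => Ext (Q (a ^ t)) M i) (f := tr a i M) g hg e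

def post (a : Ideal R) {i j k : ℕ} {M N : ModuleCat.{u} R} (β : Ext M N j) (h : i + j = k) :
    LC a i M →ₗ[R] LC a k N :=
  lcLift (fun t => io a k N t ∘ₗ β.postcompOfLinear R _ h) (by
    intro s t hst e
    simp only [LinearMap.comp_apply]
    change io a k N t ((res _ M i e).comp β h) = io a k N s (e.comp β h)
    rw [res_comp, io_res hst])

lemma post_io {j k : ℕ} {N : ModuleCat.{u} R} (β : Ext M N j) (h : i + j = k) (t e) :
    post a β h (io a i M t e) = io a k N t (e.comp β h) := lcLift_io _ _ _ _

def chg {a b : Ideal R} (h : a ≤ b) (i : ℕ) (M : ModuleCat.{u} R) : LC b i M →ₗ[R] LC a i M :=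
  lcLift (fun t => io a i M t ∘ₗ res (Ideal.pow_right_mono h t) M i) (by
    intro s t hst e
    simp only [LinearMap.comp_apply]
    rw [res_res, ← res_res (Ideal.pow_le_pow_right hst) (Ideal.pow_right_mono h s), io_res hst])

lemma chg_io {b : Ideal R} (h : a ≤ b) (t e) :
    chg h i M (io b i M t e) = io a i M t (res (Ideal.pow_right_mono h t) M i e) :=
  lcLift_io _ _ _ _

lemma chg_post {b : Ideal R} (hab : a ≤ b) {j k : ℕ} {N : ModuleCat.{u} R} (β : Ext M N j)
    (h : i + j = k) (x : LC b i M) :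
    chg hab k N (post b β h x) = post a β h (chg hab i M x) := by
  obtain ⟨t, e, rfl⟩ := io_surj x
  rw [post_io, chg_io, chg_io, post_io, res_comp]

section les
variable {S : ShortComplex (ModuleCat.{u} R)} (hS : S.ShortExact) (a)

include hS in
lemma les2 {i : ℕ} (x : LC a i S.X₂) (hx : post a (Ext.mk₀ S.g) (add_zero i) x = 0) :
    ∃ y, post a (Ext.mk₀ S.f) (add_zero i) y = x := by
  obtain ⟨t, e, rfl⟩ := io_surj x
  rw [post_io] at hx
  obtain ⟨s, h, h0⟩ := io_zero _ hx
  rw [← res_comp] at h0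
  obtain ⟨y, hy⟩ := Ext.covariant_sequence_exact₂ _ hS _ h0
  refine ⟨io a i _ s y, ?_⟩
  rw [post_io, hy, io_res h]

lemma les3 {i : ℕ} (x : LC a i S.X₃) (hx : post a hS.extClass rfl x = 0) :
    ∃ y, post a (Ext.mk₀ S.g) (add_zero i) y = x := by
  obtain ⟨t, e, rfl⟩ := io_surj x
  rw [post_io] at hx
  obtain ⟨s, h, h0⟩ := io_zero _ hx
  rw [← res_comp] at h0
  obtain ⟨y, hy⟩ := Ext.covariant_sequence_exact₃ _ hS _ _ h0
  refine ⟨io a i _ s y, ?_⟩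
  rw [post_io, hy, io_res h]

lemma les1 {i : ℕ} (x : LC a (i + 1) S.X₁) (hx : post a (Ext.mk₀ S.f) (add_zero _) x = 0) :
    ∃ y, post a hS.extClass (rfl : i + 1 = i + 1) y = x := by
  obtain ⟨t, e, rfl⟩ := io_surj x
  rw [post_io] at hx
  obtain ⟨s, h, h0⟩ := io_zero _ hx
  rw [← res_comp] at h0
  obtain ⟨y, hy⟩ := Ext.covariant_sequence_exact₁ _ hS _ h0 rfl
  refine ⟨io a i _ s y, ?_⟩
  rw [post_io, hy, io_res h]

lemma post_post {i j k l m : ℕ} {M N P : ModuleCat.{u} R} (β : Ext M N j) (γ : Ext N P l)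
    (h : i + j = k) (h' : k + l = m) (p : ℕ) (hp : j + l = p) (x : LC a i M) :
    post a γ h' (post a β h x) = post a (β.comp γ hp) (by omega : i + p = m) x := by
  obtain ⟨t, e, rfl⟩ := io_surj x
  rw [post_io, post_io, post_io, Ext.comp_assoc _ _ _ _ _ (by omega)]

lemma post_zero {i j k : ℕ} {M N : ModuleCat.{u} R} (h : i + j = k) (x : LC a i M) :
    post a (0 : Ext M N j) h x = 0 := by
  obtain ⟨t, e, rfl⟩ := io_surj x
  rw [post_io, Ext.comp_zero, map_zero]

lemma post_id {i : ℕ} {M : ModuleCat.{u} R} (x : LC a i M) :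
    post a (Ext.mk₀ (𝟙 M)) (add_zero i) x = x := by
  obtain ⟨t, e, rfl⟩ := io_surj x
  rw [post_io, Ext.comp_mk₀_id]

lemma post_add {i j k : ℕ} {M N : ModuleCat.{u} R} (β γ : Ext M N j) (h : i + j = k) (x : LC a i M) :
    post a (β + γ) h x = post a β h x + post a γ h x := by
  obtain ⟨t, e, rfl⟩ := io_surj x
  simp only [post_io, Ext.comp_add, map_add]

lemma post_smul {i j k : ℕ} {M N : ModuleCat.{u} R} (r : R) (β : Ext M N j) (h : i + j = k)
    (x : LC a i M) : post a (r • β) h x = r • post a β h x := by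
  obtain ⟨t, e, rfl⟩ := io_surj x
  simp only [post_io, Ext.comp_smul, map_smul]

end les
end basic
end LCx

namespace LCx
open Abelian

section cmp
variable {R : Type u} [CommRing R]

lemma exists_equiv_of_ker {Z A B : Type*} [AddCommGroup Z] [AddCommGroup A] [AddCommGroup B]
    [Module R Z] [Module R A] [Module R B] (f : Z →ₗ[R] A) (g : Z →ₗ[R] B)
    (hf : Function.Surjective f) (hg : Function.Surjective g)
    (h : ∀ z, f z = 0 ↔ g z = 0) : ∃ e : A ≃ₗ[R] B, ∀ z, e (f z) = g z := by
  have hk : LinearMap.ker f = LinearMap.ker g := by ext z; exact h z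
  refine ⟨(f.quotKerEquivOfSurjective hf).symm ≪≫ₗ Submodule.quotEquivOfEq _ _ hk ≪≫ₗ
    g.quotKerEquivOfSurjective hg, fun z => ?_⟩
  have : (f.quotKerEquivOfSurjective hf).symm (f z) = Submodule.Quotient.mk z := by
    rw [LinearEquiv.symm_apply_eq]; rfl
  simp only [LinearEquiv.trans_apply, this]
  rfl

variable {X : ModuleCat.{u} R} (P : ProjectiveResolution X) (Y : ModuleCat.{u} R)

abbrev KK := P.complex.linearYonedaObj R Y

variable {Y}
lemma smul_extMk {n : ℕ} (r : R) (f : P.complex.X n ⟶ Y) (m : ℕ) (hm : n + 1 = m)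
    (hf : P.complex.d m n ≫ f = 0) (hf' : P.complex.d m n ≫ (r • f) = 0) :
    P.extMk (r • f) m hm hf' = r • P.extMk f m hm hf := by
  rw [Ext.smul_eq_comp_mk₀, ProjectiveResolution.extMk_comp_mk₀]
  congr 1

lemma KK_d (n m : ℕ) (f : (KK P Y).X n) : (KK P Y).d n m f = (P.complex.d m n ≫ f : P.complex.X m ⟶ Y) := rfl

def icy (n : ℕ) (z : (KK P Y).cycles n) : P.complex.X n ⟶ Y := (KK P Y).iCycles n z

lemma icy_d (n : ℕ) (z : (KK P Y).cycles n) : P.complex.d (n+1) n ≫ icy P n z = 0 := by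
  have := congrArg (fun f => f.hom z) ((KK P Y).iCycles_d n (n+1))
  exact this

def cyNew (n : ℕ) : (KK P Y).cycles n →ₗ[R] Abelian.Ext X Y n where
  toFun z := P.extMk (icy P n z) (n+1) rfl (icy_d P n z)
  map_add' z w := by
    rw [P.add_extMk]
    congr 1
    exact map_add ((KK P Y).iCycles n).hom z w
  map_smul' r z := by
    have h : icy P n (r • z) = r • icy P n z := map_smul ((KK P Y).iCycles n).hom r z
    simp only [h, RingHom.id_apply]
    apply smul_extMk

def cyOld (n : ℕ) : (KK P Y).cycles n →ₗ[R] ((_root_.Ext R (ModuleCat.{u} R) n).obj (Opposite.op X)).obj Y :=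
  ((KK P Y).homologyπ n ≫ (P.isoExt n Y).inv).hom

lemma icy_exists (n : ℕ) (f : P.complex.X n ⟶ Y) (hf : P.complex.d (n+1) n ≫ f = 0) :
    ∃ z, icy P n z = f := 
  ⟨(KK P Y).cyclesMk (i := n) f (n+1) (by simp) hf, (KK P Y).i_cyclesMk (i := n) f (n+1) (by simp) hf⟩

lemma icy_inj (n : ℕ) (z w) (h : icy (Y := Y) P n z = icy P n w) : z = w := 
  (ModuleCat.mono_iff_injective ((KK P Y).iCycles n)).1 inferInstance h

lemma cyNew_surj (n : ℕ) : Function.Surjective (cyNew (Y := Y) P n) := by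
  intro α
  obtain ⟨f, hf, rfl⟩ := P.extMk_surjective α (n+1) rfl
  obtain ⟨z, rfl⟩ := icy_exists P n f hf
  exact ⟨z, rfl⟩

lemma cyOld_surj (n : ℕ) : Function.Surjective (cyOld (Y := Y) P n) := by
  apply (ModuleCat.epi_iff_surjective ((KK P Y).homologyπ n ≫ (P.isoExt n Y).inv)).1
  infer_instance

lemma hpi_zero (n : ℕ) (z : (KK P Y).cycles (n+1)) :
    (KK P Y).homologyπ (n+1) z = 0 ↔ ∃ w, (KK P Y).toCycles n (n+1) w = z := by
  constructor
  · intro h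
    have hex := ShortComplex.exact_of_g_is_cokernel
      (ShortComplex.mk _ _ ((KK P Y).toCycles_comp_homologyπ n (n+1)))
      ((KK P Y).homologyIsCokernel n (n+1) (by simp))
    exact (ShortComplex.moduleCat_exact_iff _).1 hex z h
  · rintro ⟨w, rfl⟩
    exact congrArg (fun f => f.hom w) ((KK P Y).toCycles_comp_homologyπ n (n+1))

lemma ker_eq (n : ℕ) (z) : cyNew (Y := Y) P (n+1) z = 0 ↔ cyOld P (n+1) z = 0 := by
  have h1 : cyOld P (n+1) z = 0 ↔ (KK P Y).homologyπ (n+1) z = 0 := by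
    exact map_eq_zero_iff (P.isoExt (R := R) (n+1) Y).inv.hom
      ((ModuleCat.mono_iff_injective (P.isoExt (R := R) (n+1) Y).inv).1 inferInstance)
  rw [h1, hpi_zero]
  refine (P.extMk_eq_zero_iff (icy P _ z) _ rfl (icy_d P _ z) n rfl).trans ?_
  refine exists_congr fun w => ?_
  have : P.complex.d (n+1) n ≫ w = icy P (n+1) ((KK P Y).toCycles n (n+1) w) :=
    (congrArg (fun f => f.hom w) ((KK P Y).toCycles_i n (n+1))).symm
  rw [this]
  exact ⟨icy_inj P _ _ _, fun h => by rw [h]⟩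

lemma exists_oldNew (n : ℕ) : ∃ e : Abelian.Ext X Y (n+1) ≃ₗ[R]
    ((_root_.Ext R (ModuleCat.{u} R) (n+1)).obj (Opposite.op X)).obj Y,
    ∀ z, e (cyNew P (n+1) z) = cyOld P (n+1) z :=
  exists_equiv_of_ker _ _ (cyNew_surj P _) (cyOld_surj P _) (ker_eq P n)

variable {X' : ModuleCat.{u} R} (P' : ProjectiveResolution X') (g : X' ⟶ X)
  (φ : ProjectiveResolution.Hom P' P g)

abbrev FY (Y : ModuleCat.{u} R) : ModuleCat.{u} R ⥤ (ModuleCat.{u} R)ᵒᵖ :=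
  ((linearYoneda R (ModuleCat.{u} R)).obj Y).rightOp

def KKmap : KK P Y ⟶ KK P' Y :=
  (HomologicalComplex.unopFunctor _ _).map (((FY Y).mapHomologicalComplex _).map φ.hom).op

lemma KKmap_f (n : ℕ) (f : P.complex.X n ⟶ Y) : (KKmap (Y := Y) P P' g φ).f n f = φ.hom.f n ≫ f := rfl

lemma cyNew_nat (n : ℕ) (z) : cyNew P' n (HomologicalComplex.cyclesMap (KKmap (Y := Y) P P' g φ) n z)
    = (Ext.mk₀ g).comp (cyNew P n z) (zero_add n) := by
  refine Eq.trans ?_ (ProjectiveResolution.mk₀_comp_extMk (icy P n z) _ rfl (icy_d P n z) φ).symm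
  have h : icy P' n (HomologicalComplex.cyclesMap (KKmap (Y := Y) P P' g φ) n z) = φ.hom.f n ≫ icy P n z :=
    congrArg (fun f => f.hom z) (HomologicalComplex.cyclesMap_i (KKmap (Y := Y) P P' g φ) n)
  simp only [← h]
  rfl

lemma sq_aux {C : Type*} [Category* C] {A B A' B' D D' : C} (hm : A ⟶ A') (o' : A' ⟶ B') (o : A ⟶ B)
    (k : B ⟶ B') (l : B ⟶ D) (l' : B' ⟶ D') (x : D ⟶ D') (h3 : o ≫ k = hm ≫ o')
    (h4 : l ≫ x = k ≫ l') : hm ≫ (o' ≫ l') = (o ≫ l) ≫ x := by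
  rw [← Category.assoc, ← h3, Category.assoc, Category.assoc, h4]

lemma cyOld_nat (n : ℕ) (z) : cyOld P' n (HomologicalComplex.cyclesMap (KKmap (Y := Y) P P' g φ) n z)
    = ((_root_.Ext R (ModuleCat.{u} R) n).map g.op).app Y (cyOld P n z) := by
  have key : HomologicalComplex.homologyMap (KKmap (Y := Y) P P' g φ) n ≫ (P'.isoExt n Y).inv = 
    (P.isoExt n Y).inv ≫ ((_root_.Ext R (ModuleCat.{u} R) n).map g.op).app Y := by
    have h1 := HomologicalComplex.homologyOp_hom_naturality (KKmap (Y := Y) P P' g φ) n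
    have h2 := P'.isoLeftDerivedObj_hom_naturality g P φ.hom (by simpa using φ.2) (FY Y) n
    have h1' : HomologicalComplex.homologyMap (((FY Y).mapHomologicalComplex _).map φ.hom) n ≫ 
      ((KK P Y).homologyOp n).hom = ((KK P' Y).homologyOp n).hom ≫ 
       (HomologicalComplex.homologyMap (KKmap (Y := Y) P P' g φ) n).op := h1
    have h3 := congrArg Quiver.Hom.unop h1'
    have h4 := congrArg Quiver.Hom.unop h2
    exact sq_aux _ _ _ _ _ _ _ h3 h4
  have h2 := HomologicalComplex.homologyπ_naturality (KKmap (Y := Y) P P' g φ) n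
  have h3 : HomologicalComplex.cyclesMap (KKmap (Y := Y) P P' g φ) n ≫ 
     ((KK P' Y).homologyπ n ≫ (P'.isoExt n Y).inv) = ((KK P Y).homologyπ n ≫ (P.isoExt n Y).inv) ≫ 
      ((_root_.Ext R (ModuleCat.{u} R) n).map g.op).app Y := by
    rw [← Category.assoc, ← h2, Category.assoc, key, Category.assoc]
  exact congrArg (fun f => f.hom z) h3

end cmp
end LCx

namespace LCx
open Abelian Limits Opposite

section cmp2
variable {R : Type u} [CommRing R]

def oldNew (X Y : ModuleCat.{u} R) (n : ℕ) : Abelian.Ext X Y (n+1) ≃ₗ[R]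
    ((_root_.Ext R (ModuleCat.{u} R) (n+1)).obj (Opposite.op X)).obj Y :=
  (exists_oldNew (Y := Y) (projectiveResolution X) n).choose

lemma oldNew_nat {X X' Y : ModuleCat.{u} R} (g : X' ⟶ X) (n : ℕ) (α : Abelian.Ext X Y (n+1)) :
    oldNew X' Y n ((Ext.mk₀ g).comp α (zero_add _)) =
      ((_root_.Ext R (ModuleCat.{u} R) (n+1)).map g.op).app Y (oldNew X Y n α) := by
  obtain ⟨z, rfl⟩ := cyNew_surj (projectiveResolution X) _ α
  let φ : ProjectiveResolution.Hom (projectiveResolution X') (projectiveResolution X) g :=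
    ⟨ProjectiveResolution.lift g _ _, by
      rw [ProjectiveResolution.lift_commutes_zero]; simp⟩
  have h1 := (exists_oldNew (Y := Y) (projectiveResolution X) n).choose_spec
  have h2 := (exists_oldNew (Y := Y) (projectiveResolution X') n).choose_spec
  rw [← cyNew_nat _ _ _ φ]
  refine (h2 _).trans ?_
  rw [cyOld_nat]
  congr 1
  exact (h1 _).symm

abbrev oldE (a : Ideal R) (n : ℕ) (M : ModuleCat.{u} R) (t : ℕ) : ModuleCat.{u} R :=
  ((_root_.Ext R (ModuleCat.{u} R) (n+1)).obj (op (Q (a^t)))).obj M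

abbrev oldT (a : Ideal R) (n : ℕ) (M : ModuleCat.{u} R) {s t : ℕ} (h : s ≤ t) :
    oldE a n M s →ₗ[R] oldE a n M t :=
  (((_root_.Ext R (ModuleCat.{u} R) (n+1)).map (qmap (Ideal.pow_le_pow_right (I := a) h)).op).app M).hom

def oio (a : Ideal R) (n : ℕ) (M : ModuleCat.{u} R) (t : ℕ) :
    oldE a n M t →ₗ[R] LC a (n+1) M :=
  io a (n+1) M t ∘ₗ (oldNew (Q (a^t)) M n).symm.toLinearMap

lemma oio_T (a : Ideal R) (n : ℕ) (M : ModuleCat.{u} R) {s t : ℕ} (h : s ≤ t) (x) :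
    oio a n M t (oldT a n M h x) = oio a n M s x := by
  obtain ⟨y, rfl⟩ := (oldNew (Q (a^s)) M n).surjective x
  have := oldNew_nat (Y := M) (qmap (Ideal.pow_le_pow_right (I := a) h)) n y
  simp only [oio, LinearMap.comp_apply, LinearEquiv.coe_coe]
  rw [LinearEquiv.symm_apply_apply]
  have h2 : (oldNew (Q (a^t)) M n).symm (oldT a n M h (oldNew (Q (a^s)) M n y)) =
     res (Ideal.pow_le_pow_right (I := a) h) M (n+1) y := by
    rw [LinearEquiv.symm_apply_eq, res_apply]
    exact this.symm
  rw [h2, io_res h]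

def lcCocone (a : Ideal R) (n : ℕ) (M : ModuleCat.{u} R) :
    Cocone (localCohomology.diagram (localCohomology.idealPowersDiagram a) (n+1) ⋙
      (evaluation _ _).obj M) where
  pt := ModuleCat.of R (LC a (n+1) M)
  ι :=
    { app := fun t => ModuleCat.ofHom (oio a n M t.unop.unop)
      naturality := by
        intro s t f
        ext x
        exact oio_T a n M (leOfHom f.unop.unop) x }

section
variable {a : Ideal R} {n : ℕ} {M : ModuleCat.{u} R}
  (s : Cocone (localCohomology.diagram (localCohomology.idealPowersDiagram a) (n+1) ⋙
      (evaluation _ _).obj M))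
def sio (t : ℕ) : oldE a n M t →ₗ[R] s.pt := (s.ι.app (op (op t))).hom

lemma sio_T {p q : ℕ} (h : p ≤ q) (x) : sio s q (oldT a n M h x) = sio s p x :=
  congrArg (fun f => f.hom x) (s.w (homOfLE h).op.op)

def sdesc : LC a (n+1) M →ₗ[R] s.pt := 
  lcLift (fun t => sio s t ∘ₗ (oldNew (Q (a^t)) M n).toLinearMap) (by
    intro p q h e
    simp only [LinearMap.comp_apply, res_apply, LinearEquiv.coe_coe]
    rw [oldNew_nat]
    exact sio_T s h _)

lemma sdesc_oio (t : ℕ) (x) : sdesc s (oio a n M t x) = sio s t x := by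
  refine (lcLift_io _ _ _ _).trans ?_
  simp only [LinearMap.comp_apply, LinearEquiv.coe_coe, LinearEquiv.apply_symm_apply]

lemma oio_surj (x : LC a (n+1) M) : ∃ t y, oio a n M t y = x := by
  obtain ⟨t, e, rfl⟩ := io_surj x
  exact ⟨t, oldNew _ M n e, by simp [oio]⟩
end

def lcIsColimit (a : Ideal R) (n : ℕ) (M : ModuleCat.{u} R) : IsColimit (lcCocone a n M) where
  desc s := ModuleCat.ofHom (sdesc s)
  fac s t := by
    ext x
    exact sdesc_oio s _ _
  uniq s m hm := by
    ext x
    obtain ⟨t, e, rfl⟩ := oio_surj x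
    refine Eq.trans ?_ (sdesc_oio s _ _).symm
    exact congrArg (fun f => f.hom e) (hm (op (op t)))

def lcEquiv (a : Ideal R) (n : ℕ) (M : ModuleCat.{u} R) :
    ((localCohomology a (n+1)).obj M) ≃ₗ[R] LC a (n+1) M :=
  ((isColimitOfPreserves ((evaluation _ _).obj M)
    (colimit.isColimit (localCohomology.diagram (localCohomology.idealPowersDiagram a) (n+1)))).coconePointUniqueUpToIso
     (lcIsColimit a n M)).toLinearEquiv

end cmp2
end LCx

namespace LCx
open Abelian

section hh
variable {R : Type u} [CommRing R]
variable {A B C N : Type u} [AddCommGroup A] [Module R A] [AddCommGroup B] [Module R B]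
  [AddCommGroup C] [Module R C] [AddCommGroup N] [Module R N]

abbrev H (a : Ideal R) (i : ℕ) (N : Type u) [AddCommGroup N] [Module R N] : Type u :=
  LC a i (ModuleCat.of R N)

def Hm (a : Ideal R) (i : ℕ) (f : A →ₗ[R] B) : H a i A →ₗ[R] H a i B :=
  post a (Ext.mk₀ (ModuleCat.ofHom f)) (add_zero i)

lemma Hm_comp (a : Ideal R) (i : ℕ) (f : A →ₗ[R] B) (g : B →ₗ[R] C) (x) :
    Hm a i g (Hm a i f x) = Hm a i (g ∘ₗ f) x := by
  unfold Hm
  rw [post_post a _ _ _ _ 0 rfl, Ext.mk₀_comp_mk₀]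
  rfl

lemma Hm_id (a : Ideal R) (i : ℕ) (x : H a i A) : Hm a i LinearMap.id x = x := post_id a x

lemma Hm_add (a : Ideal R) (i : ℕ) (f g : A →ₗ[R] B) (x) :
    Hm a i (f + g) x = Hm a i f x + Hm a i g x := by
  unfold Hm
  rw [← post_add, ← Ext.mk₀_add]
  rfl

lemma Hm_zero (a : Ideal R) (i : ℕ) (x) : Hm a i (0 : A →ₗ[R] B) x = 0 := by
  unfold Hm
  have : ModuleCat.ofHom (0 : A →ₗ[R] B) = 0 := rfl
  rw [this, Ext.mk₀_zero, post_zero]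

lemma Hm_smul (a : Ideal R) (i : ℕ) (r : R) (f : A →ₗ[R] B) (x) :
    Hm a i (r • f) x = r • Hm a i f x := by
  unfold Hm
  rw [← post_smul, ← Ext.mk₀_smul]
  rfl

lemma Hm_lsmul (a : Ideal R) (i : ℕ) (r : R) (x : H a i A) :
    Hm a i (r • LinearMap.id) x = r • x := by
  rw [Hm_smul, Hm_id]

def Hequiv (a : Ideal R) (i : ℕ) (e : A ≃ₗ[R] B) : H a i A ≃ₗ[R] H a i B :=
  LinearEquiv.ofLinearMap (Hm a i e.toLinearMap) (Hm a i e.symm.toLinearMap)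
    (by ext x; simp [Hm_comp, Hm_id]) (by ext x; simp [Hm_comp, Hm_id])

structure SES (f : A →ₗ[R] B) (g : B →ₗ[R] C) : Prop where
  inj : Function.Injective f
  exact : Function.Exact f g
  surj : Function.Surjective g

lemma SES.zero {f : A →ₗ[R] B} {g : B →ₗ[R] C} (h : SES f g) : g ∘ₗ f = 0 :=
  LinearMap.ext fun x => h.exact.apply_apply_eq_zero x

abbrev SES.sc {f : A →ₗ[R] B} {g : B →ₗ[R] C} (h : SES f g) : ShortComplex (ModuleCat.{u} R) :=
  ShortComplex.mk (ModuleCat.ofHom f) (ModuleCat.ofHom g) (by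
    ext x; exact h.exact.apply_apply_eq_zero x)

lemma SES.se {f : A →ₗ[R] B} {g : B →ₗ[R] C} (h : SES f g) : h.sc.ShortExact where
  exact := (ShortComplex.moduleCat_exact_iff _).2 (fun x hx => (h.exact x).1 hx)
  mono_f := (ModuleCat.mono_iff_injective _).2 h.inj
  epi_g := (ModuleCat.epi_iff_surjective _).2 h.surj

def Hd (a : Ideal R) (i : ℕ) {f : A →ₗ[R] B} {g : B →ₗ[R] C} (h : SES f g) :
    H a i C →ₗ[R] H a (i+1) A := post a h.se.extClass rfl

section
variable (a : Ideal R) (i : ℕ) {f : A →ₗ[R] B} {g : B →ₗ[R] C} (h : SES f g)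
include h

lemma Hex2 : Function.Exact (Hm a i f) (Hm a i g) := by
  intro x
  refine ⟨fun hx => les2 a h.se x hx, ?_⟩
  rintro ⟨y, rfl⟩
  rw [Hm_comp, h.zero, Hm_zero]

lemma Hex3 : Function.Exact (Hm a i g) (Hd a i h) := by
  intro x
  refine ⟨fun hx => les3 a h.se x hx, ?_⟩
  rintro ⟨y, rfl⟩
  unfold Hm Hd
  rw [post_post a _ _ _ _ 1 rfl]
  have := h.se.comp_extClass
  simp only at this
  rw [this, post_zero]

lemma Hex1 : Function.Exact (Hd a i h) (Hm a (i+1) f) := by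
  intro x
  refine ⟨fun hx => les1 a h.se x hx, ?_⟩
  rintro ⟨y, rfl⟩
  unfold Hm Hd
  rw [post_post a _ _ _ _ 1 rfl]
  have := h.se.extClass_comp
  simp only at this
  rw [this, post_zero]

end

lemma chg_Hm {a b : Ideal R} (hab : a ≤ b) (i : ℕ) (f : A →ₗ[R] B) (x) :
    chg hab i _ (Hm b i f x) = Hm a i f (chg hab i _ x) := chg_post hab _ _ x

lemma chg_Hd {a b : Ideal R} (hab : a ≤ b) (i : ℕ) {f : A →ₗ[R] B} {g : B →ₗ[R] C} (h : SES f g) (x) :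
    chg hab (i+1) _ (Hd b i h x) = Hd a i h (chg hab i _ x) := chg_post hab _ _ x

def Gam (a : Ideal R) (N : Type u) [AddCommGroup N] [Module R N] : Submodule R N where
  carrier := {x | ∃ k : ℕ, ∀ r ∈ a ^ k, r • x = 0}
  zero_mem' := ⟨0, by simp⟩
  add_mem' := by
    rintro x y ⟨k, hk⟩ ⟨l, hl⟩
    refine ⟨k + l, fun r hr => ?_⟩
    rw [smul_add, hk r (Ideal.pow_le_pow_right (by omega) hr),
      hl r (Ideal.pow_le_pow_right (by omega) hr), add_zero]
  smul_mem' := by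
    rintro c x ⟨k, hk⟩
    refine ⟨k, fun r hr => ?_⟩
    rw [smul_comm, hk r hr, smul_zero]

lemma mem_Gam {a : Ideal R} {x : N} : x ∈ Gam a N ↔ ∃ k : ℕ, ∀ r ∈ a ^ k, r • x = 0 := Iff.rfl

def TorsBy (a : Ideal R) (N : Type*) [AddCommGroup N] [Module R N] : Prop :=
  ∀ x : N, ∃ k : ℕ, ∀ r ∈ a ^ k, r • x = 0

lemma smul_Ext_Q (I : Ideal R) (M : ModuleCat.{u} R) (i : ℕ) (e : Ext (Q I) M i) (r : R) (hr : r ∈ I) :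
    r • e = 0 := by
  have h0 : r • (𝟙 (Q I)) = 0 := by
    apply ModuleCat.hom_ext
    apply LinearMap.ext
    intro y
    obtain ⟨y, rfl⟩ := Ideal.Quotient.mk_surjective y
    exact Ideal.Quotient.eq_zero_iff_mem.2 (I.mul_mem_right y hr)
  have : r • e = (Ext.mk₀ (r • 𝟙 (Q I))).comp e (zero_add i) := by
    rw [Ext.mk₀_smul, Ext.smul_comp, Ext.mk₀_id_comp]
  rw [this, h0, Ext.mk₀_zero, Ext.zero_comp]

lemma H_tors (a : Ideal R) (i : ℕ) (M : ModuleCat.{u} R) : TorsBy a (LC a i M) := by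
  intro x
  obtain ⟨t, e, rfl⟩ := io_surj x
  exact ⟨t, fun r hr => by rw [← map_smul, smul_Ext_Q _ _ _ _ _ hr, map_zero]⟩

lemma H_top (i : ℕ) (M : ModuleCat.{u} R) (x : LC (⊤ : Ideal R) i M) : x = 0 := by
  obtain ⟨k, hk⟩ := H_tors _ _ _ x
  simpa using hk 1 (by simp [Ideal.top_pow])

lemma H_inj (a : Ideal R) (i : ℕ) [Module.Injective R N] (x : H a (i+1) N) : x = 0 := by
  obtain ⟨t, e, rfl⟩ := io_surj x
  have : CategoryTheory.Injective (ModuleCat.of R N) := 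
    (Module.injective_iff_injective_object R N).1 inferInstance
  rw [Ext.eq_zero_of_injective e, map_zero]

variable (R N) in
lemma exists_inj : ∃ (E : Type u) (_ : AddCommGroup E) (_ : Module R E) (f : N →ₗ[R] E),
    Module.Injective R E ∧ Function.Injective f := by
  let E := Injective.under (ModuleCat.of R N)
  refine ⟨E, inferInstance, inferInstance, (Injective.ι (ModuleCat.of R N)).hom, ?_, ?_⟩
  · exact (Module.injective_iff_injective_object R E).2 (inferInstanceAs (CategoryTheory.Injective E))
  · exact (ModuleCat.mono_iff_injective (Injective.ι (ModuleCat.of R N))).1 inferInstance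

lemma SES.ofInj (f : A →ₗ[R] B) (hf : Function.Injective f) : SES f (LinearMap.range f).mkQ :=
  ⟨hf, fun x => by simp, Submodule.mkQ_surjective _⟩

lemma SES.ofSub (K : Submodule R B) : SES K.subtype K.mkQ :=
  ⟨K.injective_subtype, fun x => by simp, Submodule.mkQ_surjective _⟩

/-! degree zero -/
def ev1 (I : Ideal R) (N : Type u) [AddCommGroup N] [Module R N] :
    Ext (Q I) (ModuleCat.of R N) 0 →ₗ[R] N :=
  (LinearMap.applyₗ (1 : R ⧸ I)) ∘ₗ
    (Ext.linearEquiv₀ (R := R) ≪≫ₗ ModuleCat.homLinearEquiv (S := R)).toLinearMap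

lemma ev1_mk (I : Ideal R) (f : (R ⧸ I) →ₗ[R] N) : ev1 I N (Ext.mk₀ (ModuleCat.ofHom f)) = f 1 := by
  have : Ext.linearEquiv₀ (R := R) (Ext.mk₀ (ModuleCat.ofHom f)) = ModuleCat.ofHom f := by
    apply Ext.linearEquiv₀ (R := R).symm.injective
    rw [LinearEquiv.symm_apply_apply]; rfl
  simp only [ev1, LinearMap.comp_apply, LinearEquiv.coe_coe, LinearEquiv.trans_apply, this]
  rfl

lemma mk_surj0 (I : Ideal R) (e : Ext (Q I) (ModuleCat.of R N) 0) :
    ∃ f : (R ⧸ I) →ₗ[R] N, Ext.mk₀ (ModuleCat.ofHom f) = e := by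
  obtain ⟨f, rfl⟩ := (Ext.mk₀_bijective _ _).2 e
  exact ⟨f.hom, rfl⟩

lemma ev1_inj (I : Ideal R) : Function.Injective (ev1 I N) := by
  rw [injective_iff_map_eq_zero]
  intro e he
  obtain ⟨f, rfl⟩ := mk_surj0 I e
  rw [ev1_mk] at he
  have : f = 0 := by
    apply LinearMap.ext
    intro y
    obtain ⟨y, rfl⟩ := Ideal.Quotient.mk_surjective y
    have : (Ideal.Quotient.mk I y) = y • (1 : R ⧸ I) := by
      rw [← map_one (Ideal.Quotient.mk I)]
      exact congrArg (Ideal.Quotient.mk I) (mul_one y).symm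
    rw [this, map_smul, he, smul_zero, LinearMap.zero_apply]
  rw [this]
  exact Ext.mk₀_zero _ _

def ev0 (a : Ideal R) (N : Type u) [AddCommGroup N] [Module R N] : H a 0 N →ₗ[R] N :=
  lcLift (fun t => ev1 (a ^ t) N) (by
    intro s t h e
    obtain ⟨f, rfl⟩ := mk_surj0 _ e
    rw [res_apply, Ext.mk₀_comp_mk₀, ev1_mk]
    exact ev1_mk _ (f ∘ₗ (qmap (Ideal.pow_le_pow_right h)).hom))

lemma ev0_io (a : Ideal R) (t) (e) : ev0 a N (io a 0 _ t e) = ev1 (a ^ t) N e := lcLift_io _ _ _ _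

lemma ev0_inj (a : Ideal R) : Function.Injective (ev0 a N) := by
  rw [injective_iff_map_eq_zero]
  intro x hx
  obtain ⟨t, e, rfl⟩ := io_surj x
  rw [ev0_io] at hx
  rw [(map_eq_zero_iff _ (ev1_inj _)).1 hx, map_zero]

lemma ev0_range (a : Ideal R) (x : N) : x ∈ Gam a N ↔ ∃ y, ev0 a N y = x := by
  constructor
  · rintro ⟨k, hk⟩
    let f : (R ⧸ a ^ k) →ₗ[R] N := Submodule.liftQ _ (LinearMap.toSpanSingleton R N x) (by
      intro r hr; exact hk r hr)
    refine ⟨io a 0 _ k (Ext.mk₀ (ModuleCat.ofHom f)), ?_⟩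
    rw [ev0_io, ev1_mk]
    change (1 : R) • x = x
    rw [one_smul]
  · rintro ⟨y, rfl⟩
    obtain ⟨k, hk⟩ := H_tors a 0 _ y
    exact ⟨k, fun r hr => by rw [← map_smul, hk r hr, map_zero]⟩

lemma ev0_Hm (a : Ideal R) (f : A →ₗ[R] B) (x) : ev0 a B (Hm a 0 f x) = f (ev0 a A x) := by
  obtain ⟨t, e, rfl⟩ := io_surj x
  obtain ⟨g, rfl⟩ := mk_surj0 _ e
  unfold Hm
  rw [post_io, Ext.mk₀_comp_mk₀, ev0_io, ev0_io, ev1_mk]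
  exact ev1_mk _ (f ∘ₗ g)

lemma ev0_chg {a b : Ideal R} (hab : a ≤ b) (x : H b 0 N) : ev0 a N (chg hab 0 _ x) = ev0 b N x := by
  obtain ⟨t, e, rfl⟩ := io_surj x
  obtain ⟨g, rfl⟩ := mk_surj0 _ e
  rw [chg_io, ev0_io, ev0_io, ev1_mk, res_apply, Ext.mk₀_comp_mk₀]
  exact ev1_mk _ (g ∘ₗ (qmap (Ideal.pow_right_mono hab t)).hom)

end hh
end LCx

namespace LCx
open Abelian

section tors
variable {R : Type u} [CommRing R]
variable {A B C N : Type u} [AddCommGroup A] [Module R A] [AddCommGroup B] [Module R B]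
  [AddCommGroup C] [Module R C] [AddCommGroup N] [Module R N]

lemma tors_bound {a : Ideal R} {I : Type*} [AddCommGroup I] [Module R I] [Module.Finite R I]
    {X : Type*} [AddCommGroup X] [Module R X] (hX : TorsBy a X) (g : I →ₗ[R] X) :
    ∃ s, ∀ r ∈ a ^ s, ∀ x, r • g x = 0 := by
  obtain ⟨S, hS⟩ := Module.Finite.fg_top (R := R) (M := I)
  choose k hk using hX
  refine ⟨S.sup (fun x => k (g x)), fun r hr x => ?_⟩
  have hx : x ∈ Submodule.span R (S : Set I) := hS ▸ Submodule.mem_top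
  induction hx using Submodule.span_induction with
  | mem y hy => exact hk _ _ (Ideal.pow_le_pow_right (Finset.le_sup (f := fun x => k (g x)) hy) hr)
  | zero => simp
  | add y z _ _ h1 h2 => rw [map_add, smul_add, h1, h2, add_zero]
  | smul c y _ h => rw [map_smul, smul_comm, h, smul_zero]

lemma Gam_tors (a : Ideal R) : TorsBy a (Gam a N) := by
  rintro ⟨x, k, hk⟩
  exact ⟨k, fun r hr => Subtype.ext (hk r hr)⟩

lemma TorsBy.of_inj {a : Ideal R} {X Y : Type*} [AddCommGroup X] [Module R X] [AddCommGroup Y]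
    [Module R Y] (h : TorsBy a Y) (f : X →ₗ[R] Y) (hf : Function.Injective f) : TorsBy a X := by
  intro x
  obtain ⟨k, hk⟩ := h (f x)
  exact ⟨k, fun r hr => hf (by rw [map_smul, hk r hr, map_zero])⟩

lemma TorsBy.of_surj {a : Ideal R} {X Y : Type*} [AddCommGroup X] [Module R X] [AddCommGroup Y]
    [Module R Y] (h : TorsBy a X) (f : X →ₗ[R] Y) (hf : Function.Surjective f) : TorsBy a Y := by
  intro y
  obtain ⟨x, rfl⟩ := hf y
  obtain ⟨k, hk⟩ := h x
  exact ⟨k, fun r hr => by rw [← map_smul, hk r hr, map_zero]⟩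

lemma TorsBy.mono {a b : Ideal R} (hab : a ≤ b) {X : Type*} [AddCommGroup X] [Module R X] 
    (h : TorsBy b X) : TorsBy a X := by
  intro x
  obtain ⟨k, hk⟩ := h x
  exact ⟨k, fun r hr => hk r (Ideal.pow_right_mono hab k hr)⟩

instance Gam_inj [IsNoetherianRing R] (a : Ideal R) (E : Type u) [AddCommGroup E] [Module R E]
    [hE : Module.Injective R E] : Module.Injective R (Gam a E) := by
  apply Module.Baer.injective
  intro I g
  obtain ⟨s, hs⟩ := tors_bound (Gam_tors a) g
  obtain ⟨k, hk⟩ := Ideal.exists_pow_inf_eq_pow_smul a (M := R) I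
  have h2 := hk (k + s) (by omega)
  have h3 : ∀ z (hz : z ∈ I), z ∈ a ^ (k+s) → g ⟨z, hz⟩ = 0 := by
    intro z hz hz'
    have : z ∈ a ^ (k + s - k) • (a ^ k • ⊤ ⊓ I : Submodule R R) := by
      rw [← h2]
      exact ⟨by simpa using hz', hz⟩
    rw [Nat.add_sub_cancel_left] at this
    have hle : a ^ s • (a ^ k • ⊤ ⊓ I : Submodule R R) ≤ (LinearMap.ker g).map I.subtype := by
      rw [Submodule.smul_le]
      intro r hr n hn
      exact ⟨r • ⟨n, hn.2⟩, by rw [SetLike.mem_coe, LinearMap.mem_ker, map_smul, hs r hr], rfl⟩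
    obtain ⟨w, hw, rfl⟩ := hle this
    exact hw
  let J : Submodule R I := Submodule.comap I.subtype (a ^ (k+s))
  let f : (I ⧸ J) →ₗ[R] (R ⧸ a ^ (k+s)) := Submodule.mapQ J (a ^ (k+s)) I.subtype le_rfl
  have hf : Function.Injective f := by
    rw [injective_iff_map_eq_zero]
    intro x hx
    obtain ⟨x, rfl⟩ := Submodule.Quotient.mk_surjective _ x
    have hx' : (Submodule.Quotient.mk (x : R) : R ⧸ (a ^ (k+s))) = 0 := hx
    have hx2 : (x : R) ∈ a ^ (k+s) := (Submodule.Quotient.mk_eq_zero _).1 hx'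
    exact (Submodule.Quotient.mk_eq_zero _).2 hx2
  let g' : (I ⧸ J) →ₗ[R] E := J.liftQ ((Gam a E).subtype ∘ₗ g) (by
    rintro ⟨z, hz⟩ hz'
    rw [LinearMap.mem_ker, LinearMap.comp_apply, h3 z hz hz', map_zero])
  obtain ⟨h, hh⟩ := hE.out f hf g'
  refine ⟨LinearMap.toSpanSingleton R _ ⟨h (Submodule.Quotient.mk 1), k+s, fun r hr => ?_⟩, ?_⟩
  · rw [← map_smul, ← Submodule.Quotient.mk_smul, (Submodule.Quotient.mk_eq_zero _).2, map_zero]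
    simpa using hr
  · intro x hx
    apply Subtype.ext
    have := hh (Submodule.Quotient.mk ⟨x, hx⟩)
    refine Eq.trans ?_ this
    simp only [LinearMap.toSpanSingleton_apply, SetLike.val_smul, ← map_smul,
      ← Submodule.Quotient.mk_smul]
    simp [f]

lemma SES.H_zero_mid {a : Ideal R} {i : ℕ} {f : A →ₗ[R] B} {g : B →ₗ[R] C} (h : SES f g)
    (hA : ∀ x : H a i A, x = 0) (hC : ∀ x : H a i C, x = 0) (x : H a i B) : x = 0 := by
  obtain ⟨y, rfl⟩ := (Hex2 a i h x).1 (hC _)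
  rw [hA y, map_zero]

lemma H_of_tors [IsNoetherianRing R] {a : Ideal R} (i : ℕ) : ∀ (N : Type u) [AddCommGroup N] [Module R N],
    TorsBy a N → ∀ x : H a (i+1) N, x = 0 := by
  induction i with
  | zero =>
    intro N _ _ hN x
    obtain ⟨E, _, _, f, hE, hf⟩ := exists_inj R N
    have hr : ∀ n, f n ∈ Gam a E := fun n => by
      obtain ⟨k, hk⟩ := hN n
      exact ⟨k, fun r hr => by rw [← map_smul, hk r hr, map_zero]⟩
    let f' : N →ₗ[R] Gam a E := f.codRestrict _ hr
    have hf' : Function.Injective f' := fun x y h => hf (congrArg Subtype.val h)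
    have hs := SES.ofInj f' hf'
    obtain ⟨y, rfl⟩ := (Hex1 a 0 hs x).1 (H_inj _ _ _)
    rw [Hex3 a 0 hs y]
    obtain ⟨w, hw⟩ := Submodule.mkQ_surjective _ (ev0 _ _ y)
    obtain ⟨z, hz⟩ := (ev0_range a w).1 (Gam_tors a w)
    refine ⟨z, ev0_inj _ ?_⟩
    rw [ev0_Hm, hz, hw]
  | succ i ih =>
    intro N _ _ hN x
    obtain ⟨E, _, _, f, hE, hf⟩ := exists_inj R N
    have hr : ∀ n, f n ∈ Gam a E := fun n => by
      obtain ⟨k, hk⟩ := hN n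
      exact ⟨k, fun r hr => by rw [← map_smul, hk r hr, map_zero]⟩
    let f' : N →ₗ[R] Gam a E := f.codRestrict _ hr
    have hf' : Function.Injective f' := fun x y h => hf (congrArg Subtype.val h)
    have hs := SES.ofInj f' hf'
    obtain ⟨y, rfl⟩ := (Hex1 a (i+1) hs x).1 (H_inj _ _ _)
    rw [ih _ ((Gam_tors a).of_surj _ (Submodule.mkQ_surjective _)) y, map_zero]

lemma H_modGam [IsNoetherianRing R] (a : Ideal R) (i : ℕ) :
    Function.Bijective (Hm a (i+1) (Gam a N).mkQ) := by
  have hs := SES.ofSub (Gam a N)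
  constructor
  · rw [injective_iff_map_eq_zero]
    intro x hx
    obtain ⟨y, rfl⟩ := (Hex2 a _ hs x).1 hx
    rw [H_of_tors _ _ (Gam_tors a) y, map_zero]
  · intro x
    exact (Hex3 a _ hs x).1 (H_of_tors _ _ (Gam_tors a) _)

end tors
end LCx

namespace LCx
open Abelian

section dimlt
variable {R : Type*} [CommRing R]
variable {A B C N : Type*} [AddCommGroup A] [Module R A] [AddCommGroup B] [Module R B]
  [AddCommGroup C] [Module R C] [AddCommGroup N] [Module R N]

variable (R N) in
def DimLT (d : ℕ) : Prop := Module.supportDim R N < (d : WithBot ℕ∞)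

lemma dimLT_iff {d : ℕ} : DimLT R N d ↔ ∀ l : LTSeries (Module.support R N), l.length < d :=
  Order.krullDim_lt_coe_iff

lemma DimLT.mono {d e : ℕ} (h : DimLT R N d) (hde : d ≤ e) : DimLT R N e :=
  lt_of_lt_of_le h (by exact_mod_cast hde)

lemma DimLT.of_inj {d : ℕ} (h : DimLT R B d) (f : A →ₗ[R] B) (hf : Function.Injective f) :
    DimLT R A d := lt_of_le_of_lt (Module.supportDim_le_of_injective f hf) h

lemma DimLT.of_surj {d : ℕ} (h : DimLT R A d) (f : A →ₗ[R] B) (hf : Function.Surjective f) :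
    DimLT R B d := lt_of_le_of_lt (Module.supportDim_le_of_surjective f hf) h

lemma DimLT.of_sub {d : ℕ} (h : DimLT R B d) 
    (hs : Module.support R A ⊆ Module.support R B) : DimLT R A d :=
  lt_of_le_of_lt (Order.krullDim_le_of_strictMono (fun a ↦ ⟨a.1, hs a.2⟩) (fun {_ _} lt ↦ lt)) h

lemma dimLT_zero : DimLT R N 0 ↔ Subsingleton N := by
  rw [← Module.supportDim_eq_bot_iff_subsingleton R]
  unfold DimLT
  constructor
  · intro h
    cases h' : Module.supportDim R N with
    | bot => rfl
    | coe a => 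
      rw [h'] at h
      have : a < (0:ℕ∞) := by exact_mod_cast h
      simp at this
  · intro h
    rw [h]; exact WithBot.bot_lt_coe _

lemma DimLT.of_exact {f : A →ₗ[R] B} {g : B →ₗ[R] C} (h : Function.Exact f g) {d : ℕ}
    (hA : DimLT R A d) (hC : DimLT R C d) : DimLT R B d := by
  have h1 : DimLT R (LinearMap.range f) d := hA.of_surj f.rangeRestrict f.surjective_rangeRestrict
  have h2 : DimLT R (LinearMap.range g) d := hC.of_inj _ (Submodule.injective_subtype _)
  have hs : Module.support R B = Module.support R (LinearMap.range f) ∪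
      Module.support R (LinearMap.range g) := 
    Module.support_of_exact (f := (LinearMap.range f).subtype) (g := g.rangeRestrict) 
     (fun x => by
      rw [Subtype.ext_iff]
      refine (h x).trans ?_
      simp) (Submodule.injective_subtype _) g.surjective_rangeRestrict
  rw [dimLT_iff] at *
  intro l
  have hl := (Set.ext_iff.1 hs _).1 l.head.2
  rcases hl with hl | hl
  · have key : ∀ i, (l.toFun i).1 ∈ Module.support R (LinearMap.range f) := fun i =>
      Module.mem_support_mono (l.head_le i) hl
    exact h1 ⟨l.length, fun i => ⟨_, key i⟩, fun i => l.step i⟩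
  · have key : ∀ i, (l.toFun i).1 ∈ Module.support R (LinearMap.range g) := fun i =>
      Module.mem_support_mono (l.head_le i) hl
    exact h2 ⟨l.length, fun i => ⟨_, key i⟩, fun i => l.step i⟩

lemma wb_aux {s S : WithBot ℕ∞} {d : ℕ} (h : s + 1 ≤ S) (hS : S < ((d+1 : ℕ) : WithBot ℕ∞)) :
    s < (d : WithBot ℕ∞) := by
  have := lt_of_le_of_lt h hS
  cases s with
  | bot => exact WithBot.bot_lt_coe _
  | coe a =>
    have h1 : a + 1 < ((d + 1 : ℕ) : ℕ∞) := by exact_mod_cast this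
    have h2 : a < (d : ℕ∞) := by
      push_cast at h1
      exact lt_of_add_lt_add_right h1
    exact_mod_cast h2

lemma wb_aux' {s S : WithBot ℕ∞} {d : ℕ} (h : S ≤ s + 1) (hS : s < ((d : ℕ) : WithBot ℕ∞)) :
    S < ((d + 1 : ℕ) : WithBot ℕ∞) := by
  refine lt_of_le_of_lt h ?_
  cases s with
  | bot => exact WithBot.bot_lt_coe _
  | coe a =>
    have h1 : a < (d : ℕ∞) := by exact_mod_cast hS
    have h2 : a + 1 < ((d + 1 : ℕ) : ℕ∞) := by
      push_cast
      exact (ENat.add_lt_add_iff_right (by simp)).2 h1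
    exact_mod_cast h2

lemma DimLT.quot_min [IsNoetherianRing R] [Module.Finite R N] {x : R} 
    (hx : ∀ p ∈ (Module.annihilator R N).minimalPrimes, x ∉ p) {d : ℕ}
    (h : DimLT R N (d+1)) : DimLT R (QuotSMulTop x N) d :=
  wb_aux (Module.supportDim_quotSMulTop_succ_le_of_notMem_minimalPrimes hx) h

lemma DimLT.quot [IsNoetherianRing R] [Module.Finite R N] {x : R} (hx : IsSMulRegular N x) {d : ℕ}
    (h : DimLT R N (d+1)) : DimLT R (QuotSMulTop x N) d :=
  h.quot_min (fun _ => hx.notMem_of_mem_minimalPrimes)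

open IsLocalRing in
lemma DimLT.of_quot [IsLocalRing R] [IsNoetherianRing R] [Module.Finite R N] {x : R} 
   (hx : x ∈ maximalIdeal R) {d : ℕ} (h : DimLT R (QuotSMulTop x N) d) : DimLT R N (d+1) :=
  wb_aux' (Module.supportDim_le_supportDim_quotSMulTop_succ hx) h

open IsLocalRing in
lemma pow_le_of_primes [IsNoetherianRing R] {m : Ideal R} (J : Ideal R) 
    (h : ∀ P : Ideal R, P.IsPrime → J ≤ P → m ≤ P) : ∃ s, m ^ s ≤ J := by
  have h1 : m ≤ J.radical := by
    rw [Ideal.radical_eq_sInf]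
    exact le_sInf fun P hP => h P hP.2 hP.1
  exact Ideal.exists_pow_le_of_le_radical_of_fg_radical h1 (IsNoetherian.noetherian _)

open IsLocalRing

variable [IsLocalRing R]

lemma dimLT_one_of_pow {s : ℕ} (h : ∀ r ∈ maximalIdeal R ^ s, ∀ x : N, r • x = 0) : DimLT R N 1 := by
  rw [dimLT_iff]
  intro l
  by_contra hl
  have hl : 0 < l.length := by omega
  have key : ∀ P ∈ Module.support R N, maximalIdeal R ≤ P.asIdeal := by
    intro P hP
    have h1 := Module.annihilator_le_of_mem_support hP
    refine P.2.le_of_pow_le (n := s) (le_trans (fun r hr => ?_) h1)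
    rw [Module.mem_annihilator]
    exact h r hr
  have h2 := l.strictMono (show (⟨0, by omega⟩ : Fin (l.length+1)) < ⟨l.length, by omega⟩ from hl)
  have h3 := key _ (l.toFun ⟨0, by omega⟩).2
  have h4 : (l.toFun ⟨0, by omega⟩).1.asIdeal < (l.toFun ⟨l.length, by omega⟩).1.asIdeal := h2
  exact absurd (lt_of_le_of_lt h3 h4) 
    (not_lt_of_ge (le_maximalIdeal (l.toFun ⟨l.length, by omega⟩).1.2.ne_top))

lemma dimLT_one_of_tors [Module.Finite R N] (h : TorsBy (maximalIdeal R) N) : DimLT R N 1 := by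
  obtain ⟨s, hs⟩ := tors_bound h (LinearMap.id : N →ₗ[R] N)
  exact dimLT_one_of_pow hs

lemma tors_of_dimLT_one [IsNoetherianRing R] [Module.Finite R N] (h : DimLT R N 1) : 
    TorsBy (maximalIdeal R) N := by
  obtain ⟨s, hs⟩ := pow_le_of_primes (m := maximalIdeal R) (Module.annihilator R N) (by
    intro P hP hJ
    by_contra hm
    have hlt : P < maximalIdeal R := lt_of_le_of_ne (le_maximalIdeal hP.ne_top) (fun hh => hm hh.ge)
    have a1 : (⟨P, hP⟩ : PrimeSpectrum R) ∈ Module.support R N := 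
      Module.mem_support_iff_of_finite.2 hJ
    have a2 : closedPoint R ∈ Module.support R N := 
      Module.mem_support_iff_of_finite.2 (hJ.trans hlt.le)
    refine absurd h (not_lt_of_ge ?_)
    have := Order.one_le_krullDim_iff.2 
      ⟨(⟨_, a1⟩ : Module.support R N), (⟨_, a2⟩ : Module.support R N), hlt⟩
    simpa [Module.supportDim] using this)
  intro x
  exact ⟨s, fun r hr => Module.mem_annihilator.1 (hs hr) x⟩

end dimlt

section reg
variable {R : Type u} [CommRing R] [IsNoetherianRing R]
variable {N : Type u} [AddCommGroup N] [Module R N]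

/-- general avoidance -/
lemma exists_avoid (a : Ideal R) (S : Set (Ideal R)) (hS : S.Finite) 
    (hp : ∀ p ∈ S, p.IsPrime) (h : ∀ p ∈ S, ¬ a ≤ p) : ∃ x ∈ a, ∀ p ∈ S, x ∉ p := by
  by_contra hc
  push Not at hc
  have := (Ideal.subset_union_prime_finite hS (f := id) ⊥ ⊥ (fun i hi _ _ => hp i hi) (I := a)).1 (by
    intro x hx
    obtain ⟨p, hp, hxp⟩ := hc x hx
    simp only [Set.mem_iUnion]
    exact ⟨p, hp, hxp⟩)
  obtain ⟨p, hp, hle⟩ := this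
  exact h p hp hle

lemma regular_of_avoid {x : R} (h : ∀ p ∈ associatedPrimes R N, x ∉ p) : IsSMulRegular N x := by
  by_contra hc
  have : x ∈ ⋃ p ∈ associatedPrimes R N, (p : Set R) := by
    rw [biUnion_associatedPrimes_eq_compl_regular]; exact hc
  simp only [Set.mem_iUnion] at this
  obtain ⟨p, hp, hxp⟩ := this
  exact h p hp hxp

lemma not_le_ass {a : Ideal R} (h : ∀ x ∈ Gam a N, x = 0) {p : Ideal R} 
    (hp : p ∈ associatedPrimes R N) : ¬ a ≤ p := by
  intro hle
  obtain ⟨hp1, y, hy⟩ := (isAssociatedPrime_iff_exists_injective_linearMap _ _).1 hp |>.elim 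
    fun h1 h2 => (⟨h1, h2⟩ : p.IsPrime ∧ ∃ f : (R ⧸ p) →ₗ[R] N, Function.Injective f)
  have h0 : y 1 = 0 := h _ ⟨1, fun r hr => by
    rw [pow_one] at hr
    rw [← map_smul, ← map_zero y]
    congr 1
    rw [Algebra.smul_def, mul_one]
    exact Ideal.Quotient.eq_zero_iff_mem.2 (hle hr)⟩
  have := hy (h0.trans (map_zero y).symm)
  have : Nontrivial (R ⧸ p) := Ideal.Quotient.nontrivial_iff.2 hp1.ne_top
  exact one_ne_zero ‹(1 : R ⧸ p) = 0›

lemma exists_reg [Module.Finite R N] {a : Ideal R} (h : ∀ x ∈ Gam a N, x = 0) :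
    ∃ x ∈ a, IsSMulRegular N x := by
  obtain ⟨x, hx, hx'⟩ := exists_avoid a (associatedPrimes R N) (associatedPrimes.finite R N)
    (fun p hp => hp.1) (fun p hp => not_le_ass h hp)
  exact ⟨x, hx, regular_of_avoid hx'⟩

lemma Gam_quot (a : Ideal R) (x : N ⧸ Gam a N) (hx : x ∈ Gam a (N ⧸ Gam a N)) : x = 0 := by
  obtain ⟨k, hk⟩ := hx
  obtain ⟨x, rfl⟩ := Submodule.mkQ_surjective _ x
  rw [Submodule.mkQ_apply, Submodule.Quotient.mk_eq_zero]
  -- a^k x in Gam, fg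
  let g : (a ^ k : Ideal R) →ₗ[R] Gam a N := (((LinearMap.toSpanSingleton R N x)).comp 
    (Submodule.subtype (a^k))).codRestrict _ (by
      intro r
      have := hk r r.2
      rw [Submodule.mkQ_apply, ← Submodule.Quotient.mk_smul, Submodule.Quotient.mk_eq_zero] at this
      exact this)
  obtain ⟨s, hs⟩ := tors_bound (Gam_tors a) g
  refine ⟨s + k, fun r hr => ?_⟩
  rw [pow_add] at hr
  induction hr using Submodule.mul_induction_on' with
  | mem_mul_mem r hr t ht => 
    have := congrArg Subtype.val (hs r hr ⟨t, ht⟩)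
    rw [mul_smul]
    exact this
  | add r _ t _ h1 h2 => rw [add_smul, h1, h2, add_zero]

open Pointwise in
lemma SES.ofReg {x : R} (hx : IsSMulRegular N x) : 
    SES (x • (LinearMap.id : N →ₗ[R] N)) (Submodule.mkQ (x • (⊤ : Submodule R N))) := by
  refine ⟨hx, fun y => ?_, Submodule.mkQ_surjective _⟩
  simp [Submodule.mem_smul_pointwise_iff_exists]

end reg

end LCx

namespace LCx
open Abelian IsLocalRing Pointwise
set_option linter.unusedSectionVars false

section van
variable {R : Type u} [CommRing R] [IsNoetherianRing R]
variable {A B C N : Type u} [AddCommGroup A] [Module R A] [AddCommGroup B] [Module R B]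
  [AddCommGroup C] [Module R C] [AddCommGroup N] [Module R N]

lemma H_sub [Subsingleton N] (a : Ideal R) (i : ℕ) (x : H a i N) : x = 0 := by
  rw [← Hm_id a i x, show (LinearMap.id : N →ₗ[R] N) = 0 from Subsingleton.elim _ _, Hm_zero]

lemma eq_zero_of_tors {X : Type*} [AddCommGroup X] [Module R X] {a : Ideal R} (h : TorsBy a X) {x : R} (hx : x ∈ a)
    (hreg : ∀ u : X, x • u = 0 → u = 0) (u : X) : u = 0 := by
  obtain ⟨k, hk⟩ := h u
  have : ∀ j, x ^ j • u = 0 → u = 0 := by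
    intro j
    induction j with
    | zero => simp
    | succ j ih => 
      intro hj
      rw [pow_succ', mul_smul] at hj
      exact ih (hreg _ hj)
  exact this k (hk _ (Ideal.pow_mem_pow hx k))

/-- induction along powers of `x` -/
lemma tors_induct {X : Type*} [AddCommGroup X] [Module R X] {a : Ideal R} (h : TorsBy a X) {x : R} (hx : x ∈ a)
    (P : X → Prop) (h0 : P 0) (hs : ∀ u : X, P (x • u) → P u) (u : X) : P u := by
  obtain ⟨k, hk⟩ := h u
  have : ∀ j (u : X), x ^ j • u = 0 → P u := by
    intro j
    induction j with
    | zero => 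
      intro u hu
      rw [pow_zero, one_smul] at hu
      rwa [hu]
    | succ j ih => 
      intro u hj
      rw [pow_succ, mul_smul] at hj
      exact hs _ (ih _ hj)
  exact this k u (hk _ (Ideal.pow_mem_pow hx k))

lemma H_van (a : Ideal R) (d : ℕ) : ∀ (N : Type u) [AddCommGroup N] [Module R N] [Module.Finite R N],
    DimLT R N d → ∀ i, d ≤ i → ∀ x : H a i N, x = 0 := by
  induction d with
  | zero =>
    intro N _ _ _ h i _ x
    have := dimLT_zero.1 h
    exact H_sub a i x
  | succ d ih =>
    intro N _ _ _ h i hi u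
    obtain ⟨j, rfl⟩ : ∃ j, i = j + 1 := ⟨i - 1, by omega⟩
    apply (H_modGam a j (N := N)).1
    rw [map_zero]
    set N' := N ⧸ Gam a N
    have hN' : DimLT R N' (d+1) := h.of_surj _ (Submodule.mkQ_surjective _)
    obtain ⟨x, hx, hreg⟩ := exists_reg (Gam_quot (N := N) a)
    have hq := hN'.quot hreg
    refine eq_zero_of_tors (H_tors _ _ _) hx ?_ _
    intro v hv
    have hses := SES.ofReg hreg
    rw [← Hm_lsmul] at hv
    obtain ⟨w, rfl⟩ := (Hex1 a j hses v).1 hv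
    rw [ih _ hq j (by omega) w, map_zero]

lemma H_rex (a : Ideal R) {f : A →ₗ[R] B} {g : B →ₗ[R] C} (h : SES f g) [Module.Finite R A] {n : ℕ}
    (hA : DimLT R A (n+1)) : Function.Surjective (Hm a n g) := by
  intro x
  exact (Hex3 a n h x).1 (H_van a _ _ hA _ le_rfl _)

lemma H_rex' (a : Ideal R) [Module.Finite R B] {g : B →ₗ[R] C} (hg : Function.Surjective g) {n : ℕ}
    (hB : DimLT R B (n+1)) : Function.Surjective (Hm a n g) := by
  have : SES (LinearMap.ker g).subtype g := ⟨Submodule.injective_subtype _, fun x => by simp, hg⟩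
  exact H_rex a this (hB.of_inj _ (Submodule.injective_subtype _))

variable {a b : Ideal R} (hab : a ≤ b)

lemma chg_surj_step {x : R} (hx : x ∈ a) (hreg : IsSMulRegular N x) (i : ℕ)
    (h1 : ∀ v : H b (i+1) (QuotSMulTop x N), chg hab (i+1) _ v = 0 → v = 0)
    (h2 : Function.Surjective (chg hab i (ModuleCat.of R (QuotSMulTop x N)))) : 
    Function.Surjective (chg hab (i+1) (ModuleCat.of R N)) := by
  have hses := SES.ofReg hreg
  intro h
  refine tors_induct (H_tors _ _ _) hx (fun h => ∃ u, chg hab (i+1) (ModuleCat.of R N) u = h) 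
    ⟨0, map_zero _⟩ ?_ h
  rintro h ⟨u, hu⟩
  have h3 : Hm b (i+1) (Submodule.mkQ (x • (⊤ : Submodule R N))) u = 0 := by
    apply h1
    rw [chg_Hm hab, hu, ← Hm_lsmul]
    exact (Hex2 a (i+1) hses _).2 ⟨_, rfl⟩
  obtain ⟨u', rfl⟩ := (Hex2 b (i+1) hses _).1 h3
  have h4 : Hm a (i+1) (x • (LinearMap.id : N →ₗ[R] N)) (h - chg hab (i+1) _ u') = 0 := by
    rw [map_sub, ← chg_Hm hab, hu, Hm_lsmul, sub_self]
  obtain ⟨w, hw⟩ := (Hex1 a i hses _).1 h4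
  obtain ⟨w', rfl⟩ := h2 w
  refine ⟨u' + Hd b i hses w', ?_⟩
  rw [map_add, chg_Hd hab, hw]
  abel

lemma chg_surj_top [IsLocalRing R] (ha : a ≤ maximalIdeal R) (i : ℕ) : 
    ∀ (N : Type u) [AddCommGroup N] [Module R N] [Module.Finite R N],
    DimLT R N (i+1) → Function.Surjective (chg ha i (ModuleCat.of R N)) := by
  induction i with
  | zero => 
    intro N _ _ _ h x
    obtain ⟨y, hy⟩ := (ev0_range (maximalIdeal R) (ev0 a N x)).1 (tors_of_dimLT_one h _)
    refine ⟨y, ev0_inj _ ?_⟩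
    rw [← hy]
    exact ev0_chg ha y
  | succ i ih =>
    intro N _ _ _ h
    have hN' : DimLT R (N ⧸ Gam a N) (i+1+1) := h.of_surj _ (Submodule.mkQ_surjective _)
    have key : Function.Surjective (chg ha (i+1) (ModuleCat.of R (N ⧸ Gam a N))) := by
      obtain ⟨x, hx, hreg⟩ := exists_reg (Gam_quot (N := N) a)
      have hq := hN'.quot hreg
      exact chg_surj_step ha hx hreg i (fun v _ => H_van _ _ _ hq _ le_rfl v) (ih _ hq)
    intro y
    obtain ⟨u, hu⟩ := key (Hm a (i+1) (Gam a N).mkQ y)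
    obtain ⟨v, rfl⟩ := H_rex' (maximalIdeal R) (g := (Gam a N).mkQ) (Submodule.mkQ_surjective _) h u
    refine ⟨v, (H_modGam a i (N := N)).1 ?_⟩
    rw [← hu, chg_Hm ha]

lemma H_tors_top [IsLocalRing R] (ha : a ≤ maximalIdeal R) (i : ℕ) [Module.Finite R N] 
    (h : DimLT R N (i+1)) : TorsBy (maximalIdeal R) (H a i N) :=
  (H_tors (maximalIdeal R) i (ModuleCat.of R N)).of_surj _ (chg_surj_top ha i N h)

/-- condition that b-torsion and a-torsion agree -/
def Cof (a b : Ideal R) (N : Type u) [AddCommGroup N] [Module R N] : Prop :=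
  ∃ s, b ^ s ≤ a ⊔ Module.annihilator R N

lemma Cof.of_surj (h : Cof a b A) (f : A →ₗ[R] B) (hf : Function.Surjective f) : Cof a b B := by
  obtain ⟨s, hs⟩ := h
  exact ⟨s, hs.trans (sup_le_sup le_rfl (f.annihilator_le_of_surjective hf))⟩

lemma sup_pow_le_aux (a J : Ideal R) (k : ℕ) : (a ⊔ J) ^ k ≤ a ^ k ⊔ J := by
  induction k with
  | zero => simp
  | succ k ih =>
    rw [pow_succ, pow_succ]
    refine (Ideal.mul_mono_left ih).trans ?_
    rw [Ideal.sup_mul, Ideal.mul_sup]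
    have h1 : a ^ k * J ≤ J := Ideal.mul_le_right
    have h2 : J * (a ⊔ J) ≤ J := Ideal.mul_le_left
    exact sup_le (sup_le le_sup_left (h1.trans le_sup_right)) (h2.trans le_sup_right)

lemma Cof.Gam_eq (h : Cof a b N) (hab : a ≤ b) : Gam a N = Gam b N := by
  apply le_antisymm
  · rintro x ⟨k, hk⟩
    obtain ⟨s, hs⟩ := h
    refine ⟨s * k, fun r hr => ?_⟩
    rw [pow_mul] at hr
    have h1 := (Ideal.pow_right_mono hs k).trans (sup_pow_le_aux _ _ k) hr
    obtain ⟨y, hy, z, hz, rfl⟩ := Submodule.mem_sup.1 h1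
    rw [add_smul, hk y hy, Module.mem_annihilator.1 hz, add_zero]
  · rintro x ⟨k, hk⟩
    exact ⟨k, fun r hr => hk r (Ideal.pow_right_mono hab k hr)⟩

lemma chg_bij (i : ℕ) : 
    ∀ (N : Type u) [AddCommGroup N] [Module R N] [Module.Finite R N],
    Cof a b N → Function.Bijective (chg hab i (ModuleCat.of R N)) := by
  induction i with
  | zero =>
    intro N _ _ _ h
    constructor
    · intro x y hxy
      apply ev0_inj
      rw [← ev0_chg hab x, ← ev0_chg hab y, hxy]
    · intro x
      obtain ⟨y, hy⟩ := (ev0_range b (ev0 a N x)).1 (by 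
        rw [← h.Gam_eq hab]; exact (ev0_range a _).2 ⟨_, rfl⟩)
      refine ⟨y, ev0_inj _ ?_⟩
      rw [← hy]
      exact ev0_chg hab y
  | succ i ih =>
    -- reduce to regular
    have hi : ∀ (N : Type u) [AddCommGroup N] [Module R N] [Module.Finite R N],
      Cof a b N → ∀ u, chg hab (i+1) (ModuleCat.of R N) u = 0 → u = 0 := by
      intro N _ _ _ h u hu
      have hb := H_modGam b i (N := N)
      apply hb.1
      rw [map_zero]
      have hu' : chg hab (i+1) (ModuleCat.of R (N ⧸ Gam b N)) (Hm b (i+1) (Gam b N).mkQ u) = 0 := by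
        rw [chg_Hm hab, hu, map_zero]
      revert hu'
      generalize Hm b (i+1) (Gam b N).mkQ u = v
      have hN' : Cof a b (N ⧸ Gam b N) := h.of_surj _ (Submodule.mkQ_surjective _)
      obtain ⟨x, hx, hreg⟩ := exists_reg (N := N ⧸ Gam b N) (a := a) 
        (fun x hx => Gam_quot b x (hN'.Gam_eq hab ▸ hx))
      have hses := SES.ofReg hreg
      refine tors_induct (H_tors _ _ _) (hab hx) (fun v => chg hab (i+1) (ModuleCat.of R _) v = 0 → v = 0)
        (fun _ => rfl) ?_ v
      intro v hv hv'
      have h1 := hv (by rw [map_smul, hv', smul_zero])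
      rw [← Hm_lsmul] at h1
      obtain ⟨w, rfl⟩ := (Hex1 b i hses _).1 h1
      rw [chg_Hd hab] at hv'
      obtain ⟨z, hz⟩ := (Hex3 a i hses _).1 hv'
      obtain ⟨z', rfl⟩ := (ih _ hN').2 z
      refine (Hex3 b i hses _).2 ⟨z', ?_⟩
      apply (ih _ (hN'.of_surj _ (Submodule.mkQ_surjective _))).1
      rw [chg_Hm hab]
      exact hz
    intro N _ _ _ h
    refine ⟨(injective_iff_map_eq_zero _).2 (hi N h), ?_⟩
    have hN' : Cof a b (N ⧸ Gam a N) := h.of_surj _ (Submodule.mkQ_surjective _)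
    have key : Function.Surjective (chg hab (i+1) (ModuleCat.of R (N ⧸ Gam a N))) := by
      obtain ⟨x, hx, hreg⟩ := exists_reg (Gam_quot (N := N) a)
      have hq := hN'.of_surj _ (Submodule.mkQ_surjective (x • ⊤))
      exact chg_surj_step hab hx hreg i (hi _ hq) (ih _ hq).2
    intro y
    obtain ⟨u, hu⟩ := key (Hm a (i+1) (Gam a N).mkQ y)
    have hGb : Function.Bijective (Hm b (i+1) (Gam a N).mkQ) := by
      rw [h.Gam_eq hab]; exact H_modGam b i
    obtain ⟨v, rfl⟩ := hGb.2 u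
    refine ⟨v, (H_modGam a i (N := N)).1 ?_⟩
    rw [← hu, chg_Hm hab]

end van
end LCx

namespace LCx
open Abelian IsLocalRing Pointwise
set_option linter.unusedSectionVars false

section complete
variable {R : Type u} [CommRing R] {I : Ideal R}

lemma prec_pi [hR : IsPrecomplete I R] (n : ℕ) : IsPrecomplete I (Fin n → R) := by
  constructor
  intro f hf
  have h1 : ∀ j, ∃ L : R, ∀ k, f k j ≡ L [SMOD (I ^ k • ⊤ : Ideal R)] := by
    intro j
    apply hR.prec
    intro m n hmn
    have := hf hmn
    rw [SModEq.sub_mem] at this ⊢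
    have h2 : LinearMap.proj (R := R) (φ := fun _ : Fin _ => R) j (f m - f n) ∈ Submodule.map 
      (LinearMap.proj (R := R) (φ := fun _ : Fin _ => R) j) (I ^ m • ⊤) := ⟨_, this, rfl⟩
    rw [Submodule.map_smul''] at h2
    exact Submodule.smul_mono le_rfl le_top h2
  choose L hL using h1
  refine ⟨L, fun k => ?_⟩
  rw [SModEq.sub_mem]
  have h3 : f k - L = ∑ j, (f k j - L j) • (Pi.single j 1 : Fin n → R) := by
    ext i
    simp [Finset.sum_apply, Pi.single_apply]
  rw [h3]
  refine Submodule.sum_mem _ fun j _ => Submodule.smul_mem_smul ?_ trivial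
  have := hL j k
  rw [SModEq.sub_mem] at this
  simpa using this

lemma finite_of_complete [IsPrecomplete I R] {K : Type u} [AddCommGroup K] [Module R K]
    [IsHausdorff I K] (h : Module.Finite R (K ⧸ (I • ⊤ : Submodule R K))) : Module.Finite R K := by
  obtain ⟨n, s, hs⟩ := Module.Finite.exists_fin (R := R) (M := K ⧸ (I • ⊤ : Submodule R K))
  choose t ht using fun i => Submodule.mkQ_surjective _ (s i)
  have := prec_pi (I := I) n
  let f : (Fin n → R) →ₗ[R] K := Fintype.linearCombination R t
  have hf : Function.Surjective f := by
    apply surjective_of_mkQ_comp_surjective (I := I)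
    rw [← LinearMap.range_eq_top, ← top_le_iff, ← hs, Submodule.span_le]
    rintro _ ⟨i, rfl⟩
    refine ⟨Pi.single i 1, ?_⟩
    rw [LinearMap.comp_apply, Fintype.linearCombination_apply_single, one_smul]
    exact ht i
  exact Module.Finite.of_surjective f hf
end complete

section hull
variable {R : Type u} [CommRing R]

/-- essential extension: every nonzero element of U has a multiple that is nonzero in K0 -/
def Ess {E : Type u} [AddCommGroup E] [Module R E] (K U : Submodule R E) : Prop :=
  ∀ u ∈ U, u ≠ 0 → ∃ r : R, r • u ∈ K ∧ r • u ≠ 0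

lemma exists_hull (k : Type u) [AddCommGroup k] [Module R k] :
    ∃ (E : Type u) (_ : AddCommGroup E) (_ : Module R E) (f : k →ₗ[R] E),
      Module.Injective R E ∧ Function.Injective f ∧ 
      ∀ u : E, u ≠ 0 → ∃ r : R, r • u ∈ LinearMap.range f ∧ r • u ≠ 0 := by
  obtain ⟨E, _, _, f, hE, hf⟩ := exists_inj R k
  let K := LinearMap.range f
  obtain ⟨U, hKU, hU⟩ := zorn_le_nonempty₀ {U : Submodule R E | Ess K U} (by
    intro c hc hch y hy
    refine ⟨sSup c, ?_, fun z hz => le_sSup hz⟩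
    intro u hu hu0
    obtain ⟨V, hV, huV⟩ := (Submodule.mem_sSup_of_directed ⟨y, hy⟩ hch.directedOn).1 hu
    exact hc hV u huV hu0) K (fun u hu h0 => ⟨1, by simpa using hu, by simpa using h0⟩)
  obtain ⟨W, -, hW⟩ := zorn_le_nonempty₀ {W : Submodule R E | Disjoint W U} (by
    intro c hc hch y hy
    refine ⟨sSup c, ?_, fun z hz => le_sSup hz⟩
    rw [Set.mem_setOf_eq, Submodule.disjoint_def]
    intro u hu hu0
    obtain ⟨V, hV, huV⟩ := (Submodule.mem_sSup_of_directed ⟨y, hy⟩ hch.directedOn).1 hu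
    exact Submodule.disjoint_def.1 (hc hV) u huV hu0) ⊥ disjoint_bot_left
  have hWU : Disjoint W U := hW.prop
  -- extension
  let j : U →ₗ[R] E ⧸ W := W.mkQ ∘ₗ U.subtype
  have hj : Function.Injective j := by
    rw [injective_iff_map_eq_zero]
    intro u hu
    have hu' : (u : E) ∈ W := by
      have : W.mkQ (u : E) = 0 := hu
      rwa [Submodule.mkQ_apply, Submodule.Quotient.mk_eq_zero] at this
    exact Subtype.ext (Submodule.disjoint_def.1 hWU _ hu' u.2)
  obtain ⟨g, hg⟩ := hE.out j hj U.subtype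
  have hess : ∀ y : E ⧸ W, y ≠ 0 → ∃ r : R, ∃ u : U, r • y = j u ∧ u ≠ 0 := by
    intro y hy
    obtain ⟨e, rfl⟩ := Submodule.mkQ_surjective _ y
    by_contra hc
    push Not at hc
    have heW : e ∉ W := fun h => hy (by rwa [Submodule.mkQ_apply, Submodule.Quotient.mk_eq_zero])
    have h1 : Disjoint (W ⊔ Submodule.span R {e}) U := by
      rw [Submodule.disjoint_def]
      intro x hx hxU
      obtain ⟨w, hw, z, hz, rfl⟩ := Submodule.mem_sup.1 hx
      obtain ⟨r, rfl⟩ := Submodule.mem_span_singleton.1 hz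
      have := hc r ⟨_, hxU⟩ (by
        show r • W.mkQ e = W.mkQ (w + r • e)
        have : W.mkQ w = 0 := by rwa [Submodule.mkQ_apply, Submodule.Quotient.mk_eq_zero]
        rw [map_add, this, zero_add, map_smul])
      exact congrArg Subtype.val this
    have h2 := hW.le_of_ge h1 le_sup_left
    exact heW (h2 (Submodule.mem_sup_right (Submodule.mem_span_singleton_self e)))
  have hginj : ∀ y : E ⧸ W, g y = 0 → y = 0 := by
    intro y hy
    by_contra h0
    obtain ⟨r, u, hu, hu0⟩ := hess y h0
    apply hu0
    have := hg u
    rw [← hu, map_smul, hy, smul_zero] at this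
    exact Subtype.ext this.symm
  have hgr : LinearMap.range g ≤ U := by
    apply hU.le_of_ge
    · rintro _ ⟨y, rfl⟩ hy
      obtain ⟨r, u, hu, hu0⟩ := hess y (fun h => hy (by rw [h, map_zero]))
      obtain ⟨s, hs, hs0⟩ := hU.prop (u : E) u.2 (fun h => hu0 (Subtype.ext h))
      refine ⟨s * r, ?_⟩
      have : (s * r) • g y = s • (u : E) := by
        rw [mul_smul, ← map_smul, hu, hg]; rfl
      rw [this]
      exact ⟨hs, hs0⟩
    · intro u hu
      exact ⟨j ⟨u, hu⟩, hg _⟩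
  let ρ : E →ₗ[R] U := (g ∘ₗ W.mkQ).codRestrict U (fun e => hgr ⟨_, rfl⟩)
  have hρ : ∀ u : U, ρ (u : E) = u := fun u => Subtype.ext (hg u)
  refine ⟨U, inferInstance, inferInstance, f.codRestrict U (fun x => hKU ⟨x, rfl⟩), ?_, ?_, ?_⟩
  · constructor
    intro X Y _ _ _ _ i hi h
    obtain ⟨h', hh'⟩ := hE.out i hi (U.subtype ∘ₗ h)
    refine ⟨ρ ∘ₗ h', fun x => ?_⟩
    rw [LinearMap.comp_apply, hh']
    exact hρ _
  · intro x y hxy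
    exact hf (congrArg Subtype.val hxy)
  · intro u hu
    obtain ⟨r, ⟨x, hx⟩, hr0⟩ := hU.prop (u : E) u.2 (fun h => hu (Subtype.ext h))
    exact ⟨r, ⟨x, Subtype.ext hx⟩, fun h => hr0 (congrArg Subtype.val h)⟩

variable (R) [IsLocalRing R]

structure EHull where
  E : Type u
  [i1 : AddCommGroup E]
  [i2 : Module R E]
  f : ResidueField R →ₗ[R] E
  inj : Module.Injective R E
  hf : Function.Injective f
  ess : ∀ u : E, u ≠ 0 → ∃ r : R, r • u ∈ LinearMap.range f ∧ r • u ≠ 0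

def theHull : EHull R := Classical.choice (by
  obtain ⟨E, i1, i2, f, h1, h2, h3⟩ := exists_hull (R := R) (ResidueField R)
  exact ⟨⟨E, f, h1, h2, h3⟩⟩)

def EE : Type u := (theHull R).E
instance : AddCommGroup (EE R) := (theHull R).i1
instance : Module R (EE R) := (theHull R).i2
instance EE_inj : Module.Injective R (EE R) := (theHull R).inj
def EEf : ResidueField R →ₗ[R] EE R := (theHull R).f
lemma EEf_inj : Function.Injective (EEf R) := (theHull R).hf
lemma EE_ess (u : EE R) (hu : u ≠ 0) : ∃ r : R, r • u ∈ LinearMap.range (EEf R) ∧ r • u ≠ 0 := 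
  (theHull R).ess u hu

lemma EE_soc (u : EE R) (hu : ∀ r ∈ maximalIdeal R, r • u = 0) : u ∈ LinearMap.range (EEf R) := by
  by_cases h0 : u = 0
  · rw [h0]; exact Submodule.zero_mem _
  obtain ⟨r, hr, hr0⟩ := EE_ess R u h0
  have hr' : IsUnit r := by
    by_contra h
    exact hr0 (hu r h)
  obtain ⟨s, hs⟩ := hr'.exists_left_inv
  have := Submodule.smul_mem _ s hr
  rwa [smul_smul, hs, one_smul] at this

variable {R}

/-- Matlis dual -/
abbrev D (X : Type u) [AddCommGroup X] [Module R X] : Type u := X →ₗ[R] EE R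

variable {X Y Z : Type u} [AddCommGroup X] [Module R X] [AddCommGroup Y] [Module R Y]
  [AddCommGroup Z] [Module R Z]

abbrev Dm (f : X →ₗ[R] Y) : D (R := R) Y →ₗ[R] D (R := R) X := LinearMap.lcomp R (EE R) f

lemma Dm_inj (f : X →ₗ[R] Y) (hf : Function.Surjective f) : Function.Injective (Dm f) := by
  intro a b hab
  ext y
  obtain ⟨x, rfl⟩ := hf y
  exact LinearMap.congr_fun hab x

lemma Dm_exact {f : X →ₗ[R] Y} {g : Y →ₗ[R] Z} (h : Function.Exact f g) : 
    Function.Exact (Dm g) (Dm f) := by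
  intro a
  constructor
  · intro ha
    -- factor through range g
    have h1 : LinearMap.ker g.rangeRestrict ≤ LinearMap.ker a := by
      intro y hy
      have : g y = 0 := by simpa using hy
      obtain ⟨x, rfl⟩ := (h y).1 this
      exact LinearMap.congr_fun ha x
    have h1' : LinearMap.ker g ≤ LinearMap.ker a := by simpa using h1
    let e := g.quotKerEquivRange
    let a' : LinearMap.range g →ₗ[R] EE R := (Submodule.liftQ (LinearMap.ker g) a h1') ∘ₗ e.symm.toLinearMap
    obtain ⟨b, hb⟩ := (EE_inj R).out (LinearMap.range g).subtype (Submodule.injective_subtype _) a'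
    refine ⟨b, ?_⟩
    ext y
    have h2 := hb (e (Submodule.Quotient.mk y))
    have h3 : a' (e (Submodule.Quotient.mk y)) = a y := by
      show (Submodule.liftQ (LinearMap.ker g) a h1') (e.symm (e _)) = _
      rw [LinearEquiv.symm_apply_apply]; rfl
    rw [h3] at h2
    exact h2
  · rintro ⟨b, rfl⟩
    ext x
    show b (g (f x)) = 0
    rw [h.apply_apply_eq_zero, map_zero]

lemma Dm_surj (f : X →ₗ[R] Y) (hf : Function.Injective f) : Function.Surjective (Dm f) := by
  intro a
  obtain ⟨b, hb⟩ := (EE_inj R).out f hf a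
  exact ⟨b, LinearMap.ext hb⟩

lemma exists_D [IsNoetherianRing R] (hX : TorsBy (maximalIdeal R) X) (x : X) (hx : x ≠ 0) : 
    ∃ a : D (R := R) X, a x ≠ 0 := by
  -- ann x ≤ m; Rx ≅ R/ann x → R/m → E
  let S := Submodule.span R {x}
  have h1 : LinearMap.ker (LinearMap.toSpanSingleton R X x) ≤ LinearMap.ker 
      ((EEf R) ∘ₗ (Algebra.linearMap R (ResidueField R))) := by
    intro r hr
    have hr' : r • x = 0 := by simpa using hr
    have hm : r ∈ maximalIdeal R := by
      intro hu
      exact hx ((hu.smul_eq_zero).1 hr')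
    have : algebraMap R (ResidueField R) r = 0 := by
      simpa using hm
    show EEf R (algebraMap R (ResidueField R) r) = 0
    rw [this, map_zero]
  let t := LinearMap.toSpanSingleton R X x
  let a' : R ⧸ LinearMap.ker t →ₗ[R] EE R := Submodule.liftQ _ _ h1
  obtain ⟨b, hb⟩ := (EE_inj R).out ((LinearMap.ker t).liftQ t le_rfl) (by
    rw [← LinearMap.ker_eq_bot, Submodule.ker_liftQ_eq_bot _ _ _ le_rfl]) a'
  refine ⟨b, ?_⟩
  have := hb (Submodule.Quotient.mk 1)
  have h2 : (LinearMap.ker t).liftQ t le_rfl (Submodule.Quotient.mk 1) = x := by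
    show t 1 = x
    simp [t]
  rw [h2] at this
  rw [this]
  show EEf R (algebraMap R (ResidueField R) 1) ≠ 0
  rw [map_one]
  intro h0
  exact one_ne_zero (EEf_inj R (h0.trans (map_zero _).symm))

/-- element killing the dual kills the module -/
lemma ann_D [IsNoetherianRing R] (hX : TorsBy (maximalIdeal R) X) (c : R) (h : ∀ a : D (R := R) X, c • a = 0) (x : X) : 
    c • x = 0 := by
  by_contra h0
  obtain ⟨a, ha⟩ := exists_D hX _ h0
  apply ha
  rw [map_smul]
  exact LinearMap.congr_fun (h a) x

lemma D_mem_smul [IsNoetherianRing R] (I : Ideal R) (κ : D (R := R) X) 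
    (h : ∀ x : X, (∀ r ∈ I, r • x = 0) → κ x = 0) : κ ∈ (I • ⊤ : Submodule R (D (R := R) X)) := by
  obtain ⟨S, hS⟩ := IsNoetherian.noetherian I
  let g : X →ₗ[R] (S → X) := LinearMap.pi (fun s => (s : R) • LinearMap.id)
  have h1 : Function.Exact (LinearMap.ker g).subtype g := fun x => by simp
  have h2 : Dm (LinearMap.ker g).subtype κ = 0 := by
    ext ⟨x, hx⟩
    apply h x
    intro r hr
    rw [← hS] at hr
    induction hr using Submodule.span_induction with
    | mem r hr => exact congrFun (show g x = 0 from hx) ⟨r, hr⟩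
    | zero => simp
    | add y z _ _ h1 h2 => rw [add_smul, h1, h2, add_zero]
    | smul c y _ h => rw [smul_eq_mul, mul_smul, h, smul_zero]
  obtain ⟨b, hb⟩ := (Dm_exact h1 κ).1 h2
  classical
  have h3 : κ = ∑ s : S, (s : R) • (b ∘ₗ LinearMap.single R (fun _ => X) s) := by
    rw [← hb]
    ext x
    rw [LinearMap.sum_apply]
    show b (g x) = _
    have : g x = ∑ s : S, Pi.single s ((s : R) • x) := by
      rw [Finset.univ_sum_single]; rfl
    rw [this, map_sum]
    refine Finset.sum_congr rfl fun s _ => ?_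
    show b (Pi.single s ((s : R) • x)) = (s : R) • b (Pi.single s x)
    rw [← map_smul, Pi.single_smul]
  rw [h3]
  exact Submodule.sum_mem _ fun s _ => Submodule.smul_mem_smul (hS ▸ Submodule.subset_span s.2) trivial

lemma D_haus (hX : TorsBy (maximalIdeal R) X) : IsHausdorff (maximalIdeal R) (D (R := R) X) := by
  constructor
  intro κ h
  ext x
  obtain ⟨k, hk⟩ := hX x
  have h1 := h k
  rw [SModEq.zero] at h1
  show κ x = 0
  clear h
  induction h1 using Submodule.smul_induction_on' with
  | smul r hr n hn => 
    show r • n x = 0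
    rw [← map_smul, hk r hr, map_zero]
  | add y _ z _ h1 h2 => rw [LinearMap.add_apply, h1, h2, add_zero]

lemma D_fin_pow [IsNoetherianRing R] (s : ℕ) : ∀ (X : Type u) [AddCommGroup X] [Module R X] [Module.Finite R X],
    (∀ r ∈ maximalIdeal R ^ s, ∀ x : X, r • x = 0) → Module.Finite R (D (R := R) X) := by
  induction s with
  | zero =>
    intro X _ _ _ h
    have : Subsingleton X := ⟨fun x y => by
      have h1 := h 1 (by simp) x
      have h2 := h 1 (by simp) y
      rw [one_smul] at h1 h2
      rw [h1, h2]⟩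
    infer_instance
  | succ s ih =>
    intro X _ _ _ h
    let Y : Submodule R X := maximalIdeal R • ⊤
    have hY : Module.Finite R (D (R := R) Y) := ih Y (by
      rintro r hr ⟨y, hy⟩
      apply Subtype.ext
      show r • y = 0
      induction hy using Submodule.smul_induction_on' with
      | smul t ht n hn => 
        rw [smul_smul]
        exact h _ (by rw [pow_succ]; exact Ideal.mul_mem_mul hr ht) _
      | add y _ z _ h1 h2 => rw [smul_add, h1, h2, add_zero])
    have hZ : Module.Finite R (D (R := R) (X ⧸ Y)) := by
      obtain ⟨n, t, ht⟩ := Module.Finite.exists_fin (R := R) (M := X ⧸ Y)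
      let ev : D (R := R) (X ⧸ Y) →ₗ[R] (Fin n → LinearMap.range (EEf R)) := 
        LinearMap.pi (fun i => (LinearMap.applyₗ (t i)).codRestrict _ (by
          intro a
          apply EE_soc
          intro r hr
          show r • a (t i) = 0
          rw [← map_smul]
          obtain ⟨w, hw⟩ := Submodule.mkQ_surjective _ (t i)
          rw [← hw, ← map_smul, Submodule.mkQ_apply, (Submodule.Quotient.mk_eq_zero _).2, map_zero]
          exact Submodule.smul_mem_smul hr trivial))
      have hev : Function.Injective ev := by
        intro a b hab
        have : Set.EqOn a b (Set.range t) := by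
          rintro _ ⟨i, rfl⟩
          exact congrArg Subtype.val (congrFun hab i)
        exact LinearMap.ext_on ht this
      have : Module.Finite R (LinearMap.range (EEf R)) := by
        have : Module.Finite R (ResidueField R) := 
          Module.Finite.of_surjective (Algebra.linearMap R (ResidueField R)) residue_surjective
        infer_instance
      exact Module.Finite.of_injective ev hev
    have hex : Function.Exact Y.subtype Y.mkQ := fun x => by simp
    have := isNoetherian_of_range_eq_ker (Dm Y.mkQ) (Dm Y.subtype) 
      ((LinearMap.exact_iff.1 (Dm_exact hex)).symm)
    infer_instance

end hull
end LCx

namespace LCx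
open Abelian IsLocalRing Pointwise
set_option linter.unusedSectionVars false

section kk
variable {R : Type u} [CommRing R] [IsNoetherianRing R] [IsLocalRing R]
variable {A B C N : Type u} [AddCommGroup A] [Module R A] [AddCommGroup B] [Module R B]
  [AddCommGroup C] [Module R C] [AddCommGroup N] [Module R N]

abbrev DK (R : Type u) [CommRing R] [IsLocalRing R] (i : ℕ) (N : Type u) [AddCommGroup N] [Module R N] : Type u :=
  D (R := R) (H (maximalIdeal R) i N)

lemma quot_map {K L : Type*} [AddCommGroup K] [Module R K] [AddCommGroup L] [Module R L] {x : R}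
    (f : K →ₗ[R] L) (h : ∀ k, f k = 0 ↔ ∃ k', x • k' = k) :
    ∃ f' : QuotSMulTop x K →ₗ[R] L, Function.Injective f' ∧ ∀ k, f' (Submodule.Quotient.mk k) = f k := by
  have hk : LinearMap.ker f = x • (⊤ : Submodule R K) := by
    ext k
    rw [LinearMap.mem_ker, h]
    simp [Submodule.mem_smul_pointwise_iff_exists]
  refine ⟨Submodule.liftQ _ f hk.ge, ?_, fun k => rfl⟩
  rw [← LinearMap.ker_eq_bot, Submodule.ker_liftQ_eq_bot _ _ _ hk.le]

lemma Dm_smul_id (x : R) (i : ℕ) (k : DK R i N) : 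
    Dm (Hm (maximalIdeal R) i (x • (LinearMap.id : N →ₗ[R] N))) k = x • k := by
  ext h
  show k (Hm _ i _ h) = x • k h
  rw [Hm_lsmul, map_smul]

lemma K_quot {x : R} (hreg : IsSMulRegular N x) (i : ℕ) :
    ∃ f' : QuotSMulTop x (DK R (i+1) N) →ₗ[R] DK R i (QuotSMulTop x N), Function.Injective f' ∧ 
      Function.Exact f' (Dm (Hm (maximalIdeal R) i (Submodule.mkQ (x • (⊤ : Submodule R N))))) := by
  have hs := SES.ofReg hreg
  obtain ⟨f', h1, h2⟩ := quot_map (x := x) (Dm (Hd (maximalIdeal R) i hs)) (by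
    intro k
    rw [Dm_exact (Hex1 (maximalIdeal R) i hs) k]
    simp only [Set.mem_range, Dm_smul_id])
  refine ⟨f', h1, ?_⟩
  intro k
  rw [Dm_exact (Hex3 (maximalIdeal R) i hs) k]
  constructor
  · rintro ⟨y, rfl⟩
    exact ⟨_, h2 y⟩
  · rintro ⟨y, rfl⟩
    obtain ⟨y, rfl⟩ := Submodule.Quotient.mk_surjective _ y
    exact ⟨y, (h2 y).symm⟩

lemma K_modGam (i : ℕ) : ∃ f : DK R (i+1) (N ⧸ Gam (maximalIdeal R) N) →ₗ[R] DK R (i+1) N, Function.Bijective f :=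
  ⟨Dm (Hm (maximalIdeal R) (i+1) (Gam (maximalIdeal R) N).mkQ), 
    Dm_inj _ (H_modGam _ i).2, Dm_surj _ (H_modGam _ i).1⟩

lemma H0_fin [Module.Finite R N] : Module.Finite R (H (maximalIdeal R) 0 N) := 
  Module.Finite.of_injective (ev0 (maximalIdeal R) N) (ev0_inj _)

lemma H0_pow [Module.Finite R N] : ∃ s, ∀ r ∈ maximalIdeal R ^ s, ∀ x : H (maximalIdeal R) 0 N, r • x = 0 := by
  have := H0_fin (R := R) (N := N)
  exact tors_bound (H_tors _ _ _) LinearMap.id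

lemma K_fin_dim [IsAdicComplete (maximalIdeal R) R] (i : ℕ) : 
    ∀ (N : Type u) [AddCommGroup N] [Module R N] [Module.Finite R N], 
    Module.Finite R (DK R i N) ∧ DimLT R (DK R i N) (i+1) := by
  induction i with
  | zero =>
    intro N _ _ _
    have := H0_fin (R := R) (N := N)
    obtain ⟨s, hs⟩ := H0_pow (R := R) (N := N)
    refine ⟨D_fin_pow s _ hs, dimLT_one_of_pow (s := s) ?_⟩
    intro r hr k
    ext h
    show r • k h = 0
    rw [← map_smul, hs r hr, map_zero]
  | succ i ih =>
    intro N _ _ _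
    obtain ⟨f, hf⟩ := K_modGam (R := R) (N := N) i
    set N' := N ⧸ Gam (maximalIdeal R) N
    suffices h : Module.Finite R (DK R (i+1) N') ∧ DimLT R (DK R (i+1) N') (i+1+1) by
      obtain ⟨h1, h2⟩ := h
      exact ⟨Module.Finite.of_surjective f hf.2, h2.of_surj f hf.2⟩
    obtain ⟨x, hx, hreg⟩ := exists_reg (Gam_quot (N := N) (maximalIdeal R))
    obtain ⟨f', hf', -⟩ := K_quot hreg i
    obtain ⟨i1, i2⟩ := ih (QuotSMulTop x N')
    have h3 : Module.Finite R (QuotSMulTop x (DK R (i+1) N')) := Module.Finite.of_injective f' hf'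
    have : IsHausdorff (maximalIdeal R) (DK R (i+1) N') := D_haus (H_tors _ _ _)
    have h4 : Module.Finite R (DK R (i+1) N') := by
      apply finite_of_complete (I := maximalIdeal R)
      have hle : x • (⊤ : Submodule R (DK R (i+1) N')) ≤ maximalIdeal R • ⊤ := by
        intro k hk
        obtain ⟨y, -, rfl⟩ := (Submodule.mem_smul_pointwise_iff_exists _ _ _).1 hk
        exact Submodule.smul_mem_smul hx trivial
      exact Module.Finite.of_surjective (Submodule.factor hle) (Submodule.factor_surjective hle)
    exact ⟨h4, DimLT.of_quot hx (i2.of_inj f' hf')⟩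

end kk
end LCx

namespace LCx
open Abelian IsLocalRing Pointwise
set_option linter.unusedSectionVars false

section kn
variable {R : Type u} [CommRing R] [IsNoetherianRing R] [IsLocalRing R]
variable {A B C N : Type u} [AddCommGroup A] [Module R A] [AddCommGroup B] [Module R B]
  [AddCommGroup C] [Module R C] [AddCommGroup N] [Module R N]

lemma dim_ker_smul {K : Type u} [AddCommGroup K] [Module R K] [Module.Finite R K] {x : R} {k : ℕ} (hk : 1 ≤ k)
    (hK : DimLT R K (k+1)) 
    (hx : ∀ p ∈ (Module.annihilator R K).minimalPrimes, p ≠ maximalIdeal R → x ∉ p)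
    (W : Submodule R K) (hW : ∀ w ∈ W, x • w = 0) : DimLT R W k := by
  by_cases hm : maximalIdeal R ∈ (Module.annihilator R K).minimalPrimes
  · obtain ⟨s, hs⟩ := pow_le_of_primes (m := maximalIdeal R) (Module.annihilator R K) (by
      intro P hP hle
      exact hm.2 ⟨hP, hle⟩ (le_maximalIdeal hP.ne_top))
    refine DimLT.mono (dimLT_one_of_pow (s := s) ?_) hk
    intro r hr w
    exact Subtype.ext (Module.mem_annihilator.1 (hs hr) w.1)
  · have h1 : DimLT R (QuotSMulTop x K) k := hK.quot_min (fun p hp => hx p hp (fun h => hm (h ▸ hp)))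
    refine h1.of_sub ?_
    rw [Module.support_quotSMulTop]
    intro p hp
    refine ⟨Module.support_subset_of_injective W.subtype W.injective_subtype hp, ?_⟩
    rw [PrimeSpectrum.mem_zeroLocus, Set.singleton_subset_iff]
    refine Module.annihilator_le_of_mem_support hp (Module.mem_annihilator.2 fun w => Subtype.ext (hW _ w.2))

lemma K_ndim_step [IsAdicComplete (maximalIdeal R) R] (k : ℕ)
    (ih : ∀ (N : Type u) [AddCommGroup N] [Module R N] [Module.Finite R N], 
      DimLT R N (k+1) → ¬ DimLT R N k → ¬ DimLT R (DK R k N) k) [Module.Finite R N]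
    (h1 : DimLT R N (k+1+1)) (h2 : ¬ DimLT R N (k+1)) (h3 : DimLT R (DK R (k+1) N) (k+1))
    (hG : ∀ x ∈ Gam (maximalIdeal R) N, x = 0) : False := by
  obtain ⟨hKf, hKd⟩ := K_fin_dim (R := R) k N
  obtain ⟨hKf', -⟩ := K_fin_dim (R := R) (k+1) N
  obtain ⟨x, hx, hxS⟩ := exists_avoid (maximalIdeal R) (associatedPrimes R N ∪ 
    {p ∈ (Module.annihilator R (DK R k N)).minimalPrimes | p ≠ maximalIdeal R})
    ((associatedPrimes.finite R N).union ((Ideal.finite_minimalPrimes_of_isNoetherianRing R _).subset (fun p hp => hp.1)))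
    (by
      rintro p (hp | hp)
      · exact hp.isPrime
      · exact hp.1.1.1)
    (by
      rintro p (hp | hp)
      · exact not_le_ass hG hp
      · intro hle
        exact hp.2 ((maximalIdeal.isMaximal R).eq_of_le hp.1.1.1.ne_top hle).symm)
  have hreg : IsSMulRegular N x := regular_of_avoid (fun p hp => hxS p (Or.inl hp))
  have hq := h1.quot hreg
  refine ih (QuotSMulTop x N) hq (fun h => h2 (DimLT.of_quot hx h)) ?_
  obtain ⟨f', hf', hex⟩ := K_quot hreg k
  have hses := SES.ofReg hreg
  have hregK : IsSMulRegular (DK R (k+1) N) x := by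
    have hs : Function.Surjective (Hm (maximalIdeal R) (k+1) (x • (LinearMap.id : N →ₗ[R] N))) := by
      intro y
      exact (Hex2 (maximalIdeal R) (k+1) hses y).1 (H_van _ _ _ hq _ le_rfl _)
    intro a b hab
    apply Dm_inj _ hs
    rw [Dm_smul_id, Dm_smul_id]
    exact hab
  have hA : DimLT R (QuotSMulTop x (DK R (k+1) N)) k := h3.quot hregK
  let g := Dm (Hm (maximalIdeal R) k (Submodule.mkQ (x • (⊤ : Submodule R N))))
  have hB : DimLT R (LinearMap.range g) k := by
    rcases Nat.eq_zero_or_pos k with rfl | hk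
    · rw [dimLT_zero]
      have : Subsingleton (DK R 0 N) := by
        refine subsingleton_of_forall_eq 0 fun κ => ?_
        ext y
        have : y = 0 := ev0_inj _ (by
          rw [map_zero]
          exact hG _ ((ev0_range _ _).2 ⟨y, rfl⟩))
        rw [this, map_zero, map_zero]
      infer_instance
    · refine dim_ker_smul hk hKd (fun p hp hpm => hxS p (Or.inr ⟨hp, hpm⟩)) _ ?_
      rintro _ ⟨κ, rfl⟩
      ext y
      show x • κ (Hm _ _ _ y) = 0
      rw [← map_smul, ← map_smul, ← Hm_lsmul, (Hex2 (maximalIdeal R) k hses _).2 ⟨_, rfl⟩, map_zero]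
  refine DimLT.of_exact (f := f') (g := g.rangeRestrict) ?_ hA hB
  intro y
  rw [← hex y]
  exact ⟨fun h => congrArg Subtype.val h, fun h => Subtype.ext h⟩

lemma K_ndim [IsAdicComplete (maximalIdeal R) R] (n : ℕ) : 
    ∀ (N : Type u) [AddCommGroup N] [Module R N] [Module.Finite R N], 
    DimLT R N (n+1) → ¬ DimLT R N n → ¬ DimLT R (DK R n N) n := by
  induction n with
  | zero =>
    intro N _ _ _ h1 h2 h3
    rw [dimLT_zero] at h2 h3
    apply h2
    refine subsingleton_of_forall_eq 0 fun x => ?_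
    obtain ⟨y, rfl⟩ := (ev0_range (maximalIdeal R) x).1 (tors_of_dimLT_one h1 x)
    by_contra hne
    have hy : y ≠ 0 := fun h => hne (by rw [h, map_zero])
    obtain ⟨a, ha⟩ := exists_D (H_tors _ _ _) y hy
    exact ha (by rw [Subsingleton.elim a 0]; rfl)
  | succ k ih =>
    intro N _ _ _ h1 h2 h3
    obtain ⟨f, hf⟩ := K_modGam (R := R) (N := N) k
    have h2' : ¬ DimLT R (N ⧸ Gam (maximalIdeal R) N) (k+1) := by
      intro h
      exact h2 (DimLT.of_exact (SES.ofSub (Gam (maximalIdeal R) N)).exact 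
        ((dimLT_one_of_tors (Gam_tors _)).mono (by omega)) h)
    have h1' : DimLT R (N ⧸ Gam (maximalIdeal R) N) (k+1+1) := h1.of_surj _ (Submodule.mkQ_surjective _)
    have h3' := h3.of_inj f hf.1
    have hG := Gam_quot (N := N) (maximalIdeal R)
    exact K_ndim_step k ih h1' h2' h3' hG

end kn
end LCx

namespace LCx
open Abelian IsLocalRing Pointwise
set_option linter.unusedSectionVars false

section ek
variable {R : Type u} [CommRing R]
variable {A B C N X : Type u} [AddCommGroup A] [Module R A] [AddCommGroup B] [Module R B]
  [AddCommGroup C] [Module R C] [AddCommGroup N] [Module R N] [AddCommGroup X] [Module R X]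

def EK (e : R) (I : Ideal R) (Y : Type u) [AddCommGroup Y] [Module R Y] : Prop :=
  ∀ (j : ℕ) (z : Ext (Q I) (ModuleCat.of R Y) (j+1)), e • z = 0

lemma EK_kill {c : R} (I : Ideal R) (h : ∀ y : N, c • y = 0) : EK c I N := by
  intro j z
  have h0 : c • (𝟙 (ModuleCat.of R N)) = 0 := by
    apply ModuleCat.hom_ext
    apply LinearMap.ext
    intro y
    exact h y
  have : c • z = z.comp (Ext.mk₀ (c • 𝟙 (ModuleCat.of R N))) (add_zero _) := by
    rw [Ext.mk₀_smul, Ext.comp_smul, Ext.comp_mk₀_id]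
  rw [this, h0, Ext.mk₀_zero, Ext.comp_zero]

lemma EK_mid {f : A →ₗ[R] B} {g : B →ₗ[R] C} (h : SES f g) {e1 e2 : R} {I : Ideal R}
    (h1 : EK e1 I A) (h2 : EK e2 I C) : EK (e2 * e1) I B := by
  intro j z
  obtain ⟨y, hy⟩ := Ext.covariant_sequence_exact₂ (Q I) h.se (e2 • z) (by
    rw [Ext.smul_comp]; exact h2 _ _)
  rw [mul_comm, mul_smul, ← hy, ← Ext.smul_comp]
  have := h1 _ y
  rw [this, Ext.zero_comp]

lemma EK_shift {f : A →ₗ[R] B} {g : B →ₗ[R] C} (h : SES f g) [Module.Injective R B] {e : R} {I : Ideal R}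
    (h1 : EK e I A) : EK e I C := by
  intro j z
  obtain ⟨y, hy⟩ := Ext.covariant_sequence_exact₃ (Q I) h.se (e • z) rfl (by
    rw [Ext.smul_comp]; exact h1 _ _)
  have : CategoryTheory.Injective h.sc.X₂ := 
    (Module.injective_iff_injective_object R B).1 inferInstance
  rw [← hy, Ext.eq_zero_of_injective y, Ext.zero_comp]

def homOf (I : Ideal R) (x : N) (hx : ∀ r ∈ I, r • x = 0) : (R ⧸ I) →ₗ[R] N :=
  Submodule.liftQ _ (LinearMap.toSpanSingleton R N x) (fun r hr => hx r hr)

lemma homOf_one (I : Ideal R) (x : N) (hx : ∀ r ∈ I, r • x = 0) : homOf I x hx 1 = x := by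
  change (1 : R) • x = x
  rw [one_smul]

lemma EK_lift {f : A →ₗ[R] B} {g : B →ₗ[R] C} (h : SES f g) {e : R} {I : Ideal R}
    (h1 : EK e I A) (c : C) (hc : ∀ r ∈ I, r • c = 0) : ∃ b : B, (∀ r ∈ I, r • b = 0) ∧ g b = e • c := by
  obtain ⟨y, hy⟩ := Ext.covariant_sequence_exact₃ (Q I) h.se (n₁ := 1)
    (e • Ext.mk₀ (ModuleCat.ofHom (homOf I c hc))) rfl (by
    rw [Ext.smul_comp]; exact h1 _ _)
  obtain ⟨θ, rfl⟩ := mk_surj0 I y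
  refine ⟨θ 1, ?_, ?_⟩
  · intro r hr
    rw [← map_smul]
    have : r • (1 : R ⧸ I) = 0 := by
      rw [← map_one (Ideal.Quotient.mk I)]
      exact Ideal.Quotient.eq_zero_iff_mem.2 (I.mul_mem_right _ hr)
    rw [this, map_zero]
  · have := congrArg (ev1 I C) hy
    rw [map_smul, ev1_mk, homOf_one] at this
    rw [← this, Ext.mk₀_comp_mk₀]
    exact (ev1_mk I (g ∘ₗ θ)).symm

def Gmap (m : Ideal R) (g : A →ₗ[R] B) : Gam m A →ₗ[R] Gam m B :=
  g.restrict (by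
    rintro x ⟨k, hk⟩
    exact ⟨k, fun r hr => by rw [← map_smul, hk r hr, map_zero]⟩)

lemma Gmap_val (m : Ideal R) (g : A →ₗ[R] B) (x : Gam m A) : (Gmap m g x : B) = g x := rfl

lemma Gmap_ses (m : Ideal R) {f : A →ₗ[R] B} {g : B →ₗ[R] C} (h : SES f g) :
    SES (Gmap m f) (Gmap m g).rangeRestrict := by
  refine ⟨?_, ?_, LinearMap.surjective_rangeRestrict _⟩
  · intro x y hxy
    exact Subtype.ext (h.inj (congrArg Subtype.val hxy))
  · intro y
    have h1 : (Gmap m g).rangeRestrict y = 0 ↔ g y = 0 := by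
      constructor
      · intro hy
        exact congrArg Subtype.val (congrArg Subtype.val hy)
      · intro hy
        exact Subtype.ext (Subtype.ext hy)
    rw [h1, h.exact y]
    constructor
    · rintro ⟨x, hx⟩
      obtain ⟨k, hk⟩ := y.2
      refine ⟨⟨x, k, fun r hr => h.inj ?_⟩, Subtype.ext hx⟩
      rw [map_smul, hx, map_zero, hk r hr]
    · rintro ⟨x, rfl⟩
      exact ⟨x, rfl⟩

variable [IsNoetherianRing R]

/-- range of `Gmap` versus kernel of connecting map -/
lemma Gmap_range (m : Ideal R) {f : A →ₗ[R] B} {g : B →ₗ[R] C} (h : SES f g) (w : H m 0 C)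
   (hw : ev0 m C w ∈ Gam m C) :
    (⟨ev0 m C w, hw⟩ : Gam m C) ∈ LinearMap.range (Gmap m g) ↔ Hd m 0 h w = 0 := by
  rw [Hex3 m 0 h w]
  constructor
  · rintro ⟨x, hx⟩
    obtain ⟨v, hv⟩ := (ev0_range m (x : B)).1 x.2
    refine ⟨v, ev0_inj m ?_⟩
    rw [ev0_Hm, hv]
    exact congrArg Subtype.val hx
  · rintro ⟨v, rfl⟩
    exact ⟨⟨ev0 m B v, (ev0_range m _).2 ⟨v, rfl⟩⟩, Subtype.ext (ev0_Hm m g v).symm⟩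

lemma ext_base {a m : Ideal R} (ham : a ≤ m) (t : ℕ) {e : R} (he : EK e (a ^ t) (Gam m X)) (g : H m 1 X)
    (hg : ∀ r ∈ a ^ t, r • g = 0) : 
    ∃ z : Ext (Q (a ^ t)) (ModuleCat.of R X) 1, io a 1 _ t z = chg ham 1 _ (e • g) := by
  obtain ⟨E, _, _, f, hE, hf⟩ := exists_inj R X
  have hs := SES.ofInj f hf
  set g0 := (LinearMap.range f).mkQ
  have heB := EK_shift (Gmap_ses m hs) he
  obtain ⟨w, rfl⟩ := (Hex1 m 0 hs g).1 (H_inj _ _ _)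
  have hw : ev0 m _ w ∈ Gam m _ := (ev0_range m _).2 ⟨w, rfl⟩
  obtain ⟨b, hb1, hb2⟩ := EK_lift (SES.ofSub (LinearMap.range (Gmap m g0))) heB
    (Submodule.Quotient.mk ⟨ev0 m _ w, hw⟩) (by
    intro r hr
    rw [← Submodule.Quotient.mk_smul, Submodule.Quotient.mk_eq_zero]
    have := (Gmap_range m hs (r • w) (by rw [map_smul]; exact Submodule.smul_mem _ _ hw)).2 (by
      rw [map_smul, hg r hr])
    convert this using 1
    exact Subtype.ext (map_smul _ _ _).symm)
  have hbI : ∀ r ∈ a ^ t, r • (b : E ⧸ LinearMap.range f) = 0 := fun r hr => congrArg Subtype.val (hb1 r hr)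
  rw [Submodule.mkQ_apply, ← Submodule.Quotient.mk_smul, Submodule.Quotient.eq] at hb2
  obtain ⟨v, hv⟩ := hb2
  let ζ : Ext (Q (a ^ t)) (ModuleCat.of R (E ⧸ LinearMap.range f)) 0 := Ext.mk₀ (ModuleCat.ofHom (homOf _ _ hbI))
  refine ⟨ζ.comp hs.se.extClass rfl, ?_⟩
  rw [← post_io, ← map_smul]
  change Hd a 0 hs _ = _
  rw [chg_Hd, ← sub_eq_zero, ← map_sub, Hex3 a 0 hs _]
  have hva : (v : E) ∈ Gam a E := by
    obtain ⟨k, hk⟩ := v.2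
    exact ⟨k, fun r hr => hk r (Ideal.pow_right_mono ham k hr)⟩
  obtain ⟨v', hv'⟩ := (ev0_range a (v : E)).1 hva
  refine ⟨v', ev0_inj a ?_⟩
  rw [ev0_Hm, hv', map_sub, ev0_io, ev0_chg, ev1_mk, homOf_one, map_smul]
  exact congrArg Subtype.val hv

lemma ext_lem {a m : Ideal R} (ham : a ≤ m) (t : ℕ) (c : R) (k : ℕ) : 
    ∀ (X : Type u) [AddCommGroup X] [Module R X] (e : R), EK e (a ^ t) (Gam m X) → 
    (∀ i, 1 ≤ i → i < k + 1 → ∀ y : H m i X, c • y = 0) → 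
    ∀ g : H m (k+1) X, (∀ r ∈ a ^ t, r • g = 0) → 
    ∃ z : Ext (Q (a ^ t)) (ModuleCat.of R X) (k+1), io a (k+1) _ t z = chg ham (k+1) _ ((c ^ k * e) • g) := by
  induction k with
  | zero =>
    intro X _ _ e he hc g hg
    obtain ⟨z, hz⟩ := ext_base ham t he g hg
    refine ⟨z, ?_⟩
    rw [pow_zero, one_mul, ← hz]
  | succ k ih =>
    intro X _ _ e he hc g hg
    obtain ⟨E, _, _, f, hE, hf⟩ := exists_inj R X
    have hs := SES.ofInj f hf
    set g0 := (LinearMap.range f).mkQ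
    have heB := EK_shift (Gmap_ses m hs) he
    have hinj : ∀ i (y : H m (i+1) (E ⧸ LinearMap.range f)), Hd m (i+1) hs y = 0 → y = 0 := by
      intro i y hy
      obtain ⟨v, rfl⟩ := (Hex3 m (i+1) hs y).1 hy
      rw [H_inj m i v, map_zero]
    obtain ⟨g', rfl⟩ := (Hex1 m (k+1) hs g).1 (H_inj _ _ _)
    obtain ⟨z', hz'⟩ := ih (E ⧸ LinearMap.range f) (c * e) 
      (EK_mid (SES.ofSub (LinearMap.range (Gmap m g0))) heB (EK_kill _ (by
        intro y
        obtain ⟨⟨y, hy⟩, rfl⟩ := Submodule.Quotient.mk_surjective _ y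
        obtain ⟨w, rfl⟩ := (ev0_range m y).1 hy
        rw [← Submodule.Quotient.mk_smul, Submodule.Quotient.mk_eq_zero]
        have := (Gmap_range m hs (c • w) (by rw [map_smul]; exact Submodule.smul_mem _ _ hy)).2 (by
          rw [map_smul]
          exact hc 1 le_rfl (by omega) _)
        convert this using 1
        exact Subtype.ext (map_smul _ _ _).symm)))
      (by
        intro i h1 h2 y
        obtain ⟨j, rfl⟩ : ∃ j, i = j + 1 := ⟨i - 1, by omega⟩
        apply hinj
        rw [map_smul]
        exact hc (j+1+1) (by omega) (by omega) _) g' (by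
        intro r hr
        apply hinj
        rw [map_smul]
        exact hg r hr)
    refine ⟨z'.comp hs.se.extClass rfl, ?_⟩
    rw [← post_io, hz']
    change Hd a (k+1) hs _ = _
    rw [← chg_Hd, map_smul, pow_succ, mul_assoc]

end ek
end LCx

namespace LCx
open Abelian IsLocalRing Pointwise
set_option linter.unusedSectionVars false

section krull
variable {R : Type u} [CommRing R] [IsNoetherianRing R]

lemma krull_P (P : Ideal R) [hP : P.IsPrime] {K : Type u} [AddCommGroup K] [Module R K] [Module.Finite R K]
    (κ : K) (h : ∀ t : ℕ, ∃ s ∉ P, s • κ ∈ (P ^ t • ⊤ : Submodule R K)) : ∃ v ∉ P, v • κ = 0 := by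
  let L := Localization.AtPrime P
  let f := LocalizedModule.mkLinearMap P.primeCompl K
  have h0 : f κ ∈ (⨅ i, maximalIdeal L ^ i • ⊤ : Submodule L (LocalizedModule P.primeCompl K)) := by
    rw [Submodule.mem_iInf]
    intro t
    obtain ⟨s, hs, hsκ⟩ := h t
    have h1 : ∀ κ' ∈ (P ^ t • ⊤ : Submodule R K), f κ' ∈ 
        (maximalIdeal L ^ t • ⊤ : Submodule L (LocalizedModule P.primeCompl K)) := by
      intro κ' hκ'
      induction hκ' using Submodule.smul_induction_on' with
      | smul r hr n hn =>
        rw [map_smul, ← algebraMap_smul L r]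
        refine Submodule.smul_mem_smul ?_ trivial
        have h2 := Ideal.mem_map_of_mem (algebraMap R L) hr
        rw [Ideal.map_pow, Localization.AtPrime.map_eq_maximalIdeal] at h2
        exact h2
      | add y _ z _ h1 h2 => rw [map_add]; exact Submodule.add_mem _ h1 h2
    have h2 := h1 _ hsκ
    rw [map_smul, ← algebraMap_smul L s] at h2
    have hu : IsUnit (algebraMap R L s) := IsLocalization.map_units L (⟨s, hs⟩ : P.primeCompl)
    obtain ⟨s', hs'⟩ := hu.exists_left_inv
    have h3 := Submodule.smul_mem _ s' h2
    rwa [smul_smul, hs', one_smul] at h3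
  rw [Ideal.iInf_pow_smul_eq_bot_of_isLocalRing _ (maximalIdeal.isMaximal L).ne_top, Submodule.mem_bot,
    IsLocalizedModule.eq_zero_iff P.primeCompl f] at h0
  obtain ⟨v, hv⟩ := h0
  exact ⟨v.1, v.2, hv⟩

lemma supp_quot (p : Ideal R) : Module.support R (R ⧸ p) = PrimeSpectrum.zeroLocus (p : Set R) := by
  rw [Module.support_of_algebra, Ideal.Quotient.algebraMap_eq, Ideal.mk_ker]

lemma exists_kill (p : Ideal R) [hp : p.IsPrime] {K : Type u} [AddCommGroup K] [Module R K] [Module.Finite R K] {d : ℕ}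
    (hd : DimLT R K d) (h : ¬ DimLT R (R ⧸ p) d) : ∃ c ∉ p, ∀ κ : K, c • κ = 0 := by
  by_contra hc
  push Not at hc
  apply h
  refine hd.of_sub ?_
  rw [supp_quot]
  intro q hq
  refine Module.mem_support_mono (p := ⟨p, hp⟩) hq ?_
  rw [Module.mem_support_iff_of_finite]
  intro c hcA
  by_contra hcp
  obtain ⟨κ, hκ⟩ := hc c hcp
  exact hκ (Module.mem_annihilator.1 hcA κ)

variable [IsLocalRing R] [IsAdicComplete (maximalIdeal R) R]

lemma exists_c (p : Ideal R) [hp : p.IsPrime] (k : ℕ) (h : ¬ DimLT R (R ⧸ p) k) (N : Type u) 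
    [AddCommGroup N] [Module R N] [Module.Finite R N] (j : ℕ) (hj : j ≤ k) : 
    ∃ c ∉ p, ∀ i < j, ∀ y : H (maximalIdeal R) i N, c • y = 0 := by
  induction j with
  | zero => exact ⟨1, p.ne_top_iff_one.1 hp.ne_top, fun i hi => absurd hi (by omega)⟩
  | succ j ih =>
    obtain ⟨c, hc, hcj⟩ := ih (by omega)
    obtain ⟨h1, h2⟩ := K_fin_dim (R := R) j N
    obtain ⟨c', hc', hcj'⟩ := exists_kill p (h2.mono hj) h
    refine ⟨c * c', fun hm => (hp.mem_or_mem hm).elim hc hc', ?_⟩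
    intro i hi y
    rcases Nat.lt_succ_iff_lt_or_eq.1 hi with hi | rfl
    · rw [mul_comm, mul_smul, hcj i hi, smul_zero]
    · rw [mul_smul, ann_D (H_tors _ _ _) c' hcj', smul_zero]

lemma quot_reg (p : Ideal R) [hp : p.IsPrime] {c : R} (hc : c ∉ p) : IsSMulRegular (R ⧸ p) c := by
  intro x y hxy
  have : Ideal.Quotient.mk p c * x = Ideal.Quotient.mk p c * y := by
    simpa [Algebra.smul_def] using hxy
  exact mul_left_cancel₀ (fun h => hc (Ideal.Quotient.eq_zero_iff_mem.1 h)) this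

lemma Gam_quot_prime (p : Ideal R) [hp : p.IsPrime] (h : ¬ maximalIdeal R ≤ p) (y : R ⧸ p)
    (hy : y ∈ Gam (maximalIdeal R) (R ⧸ p)) : y = 0 := by
  obtain ⟨k, hk⟩ := hy
  obtain ⟨r, hr, hrp⟩ := SetLike.not_le_iff_exists.1 h
  have h1 : r ^ k ∉ p := fun h => hrp (hp.mem_of_pow_mem _ h)
  exact quot_reg p h1 (by
    show r ^ k • y = r ^ k • 0
    rw [hk _ (Ideal.pow_mem_pow hr k), smul_zero])

theorem lhvt (p P a : Ideal R) [hp : p.IsPrime] [hP : P.IsPrime] (hpP : p ≤ P) (hPm : P ≠ maximalIdeal R) (haP : a ≤ P)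
    (k : ℕ) (h1 : DimLT R (R ⧸ p) (k+1+1)) (h2 : ¬ DimLT R (R ⧸ p) (k+1)) (x : H a (k+1) (R ⧸ p)) : x = 0 := by
  have hmP : ¬ maximalIdeal R ≤ P := fun h => hPm ((maximalIdeal.isMaximal R).eq_of_le hP.ne_top h).symm
  have hmp : ¬ maximalIdeal R ≤ p := fun h => hmP (h.trans hpP)
  have ha : a ≤ maximalIdeal R := haP.trans (le_maximalIdeal hP.ne_top)
  obtain ⟨c, hc, hck⟩ := exists_c p (k+1) h2 (R ⧸ p) (k+1) le_rfl
  obtain ⟨r, hr, hrP⟩ := SetLike.not_le_iff_exists.1 hmP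
  have htors := H_tors_top ha (k+1) h1
  by_contra hx
  obtain ⟨κ, hκ⟩ := exists_D htors x hx
  have hφ := chg_surj_top ha (k+1) (R ⧸ p) h1
  obtain ⟨hKf, -⟩ := K_fin_dim (R := R) (k+1) (R ⧸ p)
  let κ' : DK R (k+1) (R ⧸ p) := Dm (chg ha (k+1) _) κ
  obtain ⟨v, hv, hvκ⟩ := krull_P P (c ^ k • κ') (by
    intro t
    have := ModuleCat.finite_ext R (Q (a ^ t)) (ModuleCat.of R (R ⧸ p)) (k+1)
    obtain ⟨s, hs⟩ := tors_bound htors (io a (k+1) (ModuleCat.of R (R ⧸ p)) t)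
    refine ⟨r ^ s, fun h => hrP (hP.mem_of_pow_mem _ h), ?_⟩
    refine Submodule.smul_mono_left (Ideal.pow_right_mono haP t) (D_mem_smul (a ^ t) _ ?_)
    intro g hg
    obtain ⟨z, hz⟩ := ext_lem ha t c k (R ⧸ p) 1 (EK_kill _ (by
      rintro ⟨y, hy⟩
      rw [one_smul]
      exact Subtype.ext (Gam_quot_prime p hmp y hy))) (fun i _ hi y => hck i hi y) g hg
    show r ^ s • c ^ k • κ (chg ha (k+1) _ g) = 0
    rw [← map_smul, ← map_smul, ← map_smul]
    rw [mul_one] at hz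
    rw [← hz, hs _ (Ideal.pow_mem_pow hr s), map_zero])
  have h3 : (v * c ^ k) • κ = 0 := by
    apply Dm_inj _ hφ
    rw [map_zero, map_smul, mul_smul]
    exact hvκ
  have hcp : v * c ^ k ∉ p := fun h => (hp.mem_or_mem h).elim (fun h => hv (hpP h)) 
    (fun h => hc (hp.mem_of_pow_mem _ h))
  have hreg := quot_reg p hcp
  obtain ⟨y, rfl⟩ := (Hex2 a (k+1) (SES.ofReg hreg) x).1 (H_van _ _ _ (h1.quot hreg) _ le_rfl _)
  apply hκ
  rw [Hm_lsmul, map_smul]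
  exact LinearMap.congr_fun h3 y

end krull
end LCx

namespace LCx
open Abelian IsLocalRing Pointwise
set_option linter.unusedSectionVars false

section att
variable {R : Type u} [CommRing R] [IsNoetherianRing R]
variable {A B C M N : Type u} [AddCommGroup A] [Module R A] [AddCommGroup B] [Module R B]
  [AddCommGroup C] [Module R C] [AddCommGroup N] [Module R N] [AddCommGroup M] [Module R M]

lemma Hm_sum (a : Ideal R) (i : ℕ) {ι : Type*} (s : Finset ι) (f : ι → (A →ₗ[R] B)) (x) :
    Hm a i (∑ j ∈ s, f j) x = ∑ j ∈ s, Hm a i (f j) x := by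
  classical
  induction s using Finset.induction_on with
  | empty => simp [Hm_zero]
  | insert j s hj ih => rw [Finset.sum_insert hj, Finset.sum_insert hj, Hm_add, ih]

lemma DimLT.pi [Module.Finite R N] {ι : Type} [Finite ι] {d : ℕ} (h : DimLT R N d) : DimLT R (ι → N) d := by
  refine h.of_sub ?_
  intro p hp
  rw [Module.mem_support_iff_of_finite] at hp ⊢
  refine le_trans ?_ hp
  intro r hr
  rw [Module.mem_annihilator] at hr ⊢
  intro f
  funext j
  exact hr (f j)

lemma H_quot_ne (a p : Ideal R) (k : ℕ) [Module.Finite R M] (hM : DimLT R M (k+1)) 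
    (h : ∀ x : H a k (M ⧸ (p • ⊤ : Submodule R M)), x = 0) (x : H a k M) : 
    x ∈ (p • ⊤ : Submodule R (H a k M)) := by
  obtain ⟨y, rfl⟩ := (Hex2 a k (SES.ofSub (p • ⊤ : Submodule R M)) x).1 (h _)
  obtain ⟨n, s, hs⟩ := Submodule.fg_iff_exists_fin_generating_family.1 (IsNoetherian.noetherian p)
  have hsp : ∀ i, s i ∈ p := fun i => hs ▸ Submodule.subset_span ⟨i, rfl⟩
  let σ : (Fin n → M) →ₗ[R] M := ∑ i, s i • LinearMap.proj i
  have hσ : ∀ f, σ f ∈ (p • ⊤ : Submodule R M) := by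
    intro f
    simp only [σ, LinearMap.sum_apply, LinearMap.smul_apply, LinearMap.proj_apply]
    exact Submodule.sum_mem _ fun i _ => Submodule.smul_mem_smul (hsp i) trivial
  let σ' : (Fin n → M) →ₗ[R] (p • ⊤ : Submodule R M) := σ.codRestrict _ hσ
  have hsurj : Function.Surjective σ' := by
    rintro ⟨z, hz⟩
    suffices hh : z ∈ LinearMap.range σ by
      obtain ⟨f, hf⟩ := hh
      exact ⟨f, Subtype.ext hf⟩
    refine (Submodule.smul_le.2 ?_) hz
    intro r hr w _
    rw [← hs] at hr
    induction hr using Submodule.span_induction with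
    | mem r hr => 
      obtain ⟨i, rfl⟩ := hr
      refine ⟨Pi.single i w, ?_⟩
      simp only [σ, LinearMap.sum_apply, LinearMap.smul_apply, LinearMap.proj_apply]
      rw [Finset.sum_eq_single i]
      · simp
      · intro j _ hj
        simp [hj]
      · simp
    | zero => simp
    | add y z _ _ h1 h2 => rw [add_smul]; exact Submodule.add_mem _ h1 h2
    | smul c y _ h => rw [smul_eq_mul, mul_smul]; exact Submodule.smul_mem _ _ h
  obtain ⟨w, rfl⟩ := H_rex' a hsurj (n := k) hM.pi y
  rw [Hm_comp]
  have : (p • ⊤ : Submodule R M).subtype ∘ₗ σ' = σ := rfl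
  rw [this, Hm_sum]
  refine Submodule.sum_mem _ fun i _ => ?_
  rw [Hm_smul]
  exact Submodule.smul_mem_smul (hsp i) trivial

lemma H_pi_zero (a : Ideal R) (k : ℕ) {ι : Type} [Fintype ι] (h : ∀ x : H a k N, x = 0) (x : H a k (ι → N)) : x = 0 := by
  classical
  have : (LinearMap.id : (ι → N) →ₗ[R] (ι → N)) = ∑ i, LinearMap.single R (fun _ => N) i ∘ₗ LinearMap.proj i := by
    ext i f j
    simp [Finset.sum_apply]
  rw [← Hm_id a k x, this, Hm_sum]
  refine Finset.sum_eq_zero fun i _ => ?_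
  rw [← Hm_comp, h (Hm a k (LinearMap.proj i) x), map_zero]

lemma H_quot_zero (a p : Ideal R) (k : ℕ) [Module.Finite R M] (hp : DimLT R (R ⧸ p) (k+1)) 
    (h : ∀ x : H a k (R ⧸ p), x = 0) (x : H a k (M ⧸ (p • ⊤ : Submodule R M))) : x = 0 := by
  obtain ⟨n, s, hs⟩ := Module.Finite.exists_fin (R := R) (M := M ⧸ (p • ⊤ : Submodule R M))
  have hk : ∀ y : M ⧸ (p • ⊤ : Submodule R M), ∀ r ∈ p, r • y = 0 := by
    intro y r hr
    obtain ⟨y, rfl⟩ := Submodule.Quotient.mk_surjective _ y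
    rw [← Submodule.Quotient.mk_smul, Submodule.Quotient.mk_eq_zero]
    exact Submodule.smul_mem_smul hr trivial
  let σ : (Fin n → R ⧸ p) →ₗ[R] M ⧸ (p • ⊤ : Submodule R M) := ∑ i, homOf p (s i) (hk (s i)) ∘ₗ LinearMap.proj i
  have hsurj : Function.Surjective σ := by
    rw [← LinearMap.range_eq_top, ← top_le_iff, ← hs, Submodule.span_le]
    rintro _ ⟨i, rfl⟩
    refine ⟨Pi.single i 1, ?_⟩
    simp only [σ, LinearMap.sum_apply, LinearMap.comp_apply, LinearMap.proj_apply]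
    rw [Finset.sum_eq_single i]
    · rw [Pi.single_eq_same, homOf_one]
    · intro j _ hj
      simp [hj]
    · simp
  obtain ⟨w, rfl⟩ := H_rex' a hsurj (n := k) hp.pi x
  rw [H_pi_zero a k h w, map_zero]

lemma dim_quot_le (p : Ideal R) [Module.Finite R M] (hp : Module.annihilator R M ≤ p) {d : ℕ} (h : DimLT R M d) : 
    DimLT R (R ⧸ p) d := by
  refine h.of_sub ?_
  rw [supp_quot]
  intro q hq
  rw [Module.mem_support_iff_of_finite]
  exact hp.trans hq

variable [IsLocalRing R] [IsAdicComplete (maximalIdeal R) R]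

lemma att_A (a p : Ideal R) (hp : p.IsPrime) (k : ℕ) [Module.Finite R M] (hM : DimLT R M (k+1+1)) 
    (K' : Submodule R (H a (k+1) M)) (hK : p = Module.annihilator R (H a (k+1) M ⧸ K')) : 
    Module.annihilator R M ≤ p ∧ ¬ DimLT R (R ⧸ p) (k+1) ∧ 
      ∀ P : Ideal R, P.IsPrime → a ≤ P → p ≤ P → P = maximalIdeal R := by
  have h1 : Module.annihilator R M ≤ p := by
    intro r hr
    rw [hK, Module.mem_annihilator]
    intro y
    obtain ⟨y, rfl⟩ := Submodule.Quotient.mk_surjective _ y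
    rw [← Submodule.Quotient.mk_smul, ← Hm_lsmul]
    have : r • (LinearMap.id : M →ₗ[R] M) = 0 := by
      ext z
      exact Module.mem_annihilator.1 hr z
    rw [this, Hm_zero, Submodule.Quotient.mk_zero]
  have hd := dim_quot_le p h1 hM
  have h2 : ¬ ∀ x : H a (k+1) (R ⧸ p), x = 0 := by
    intro h
    have h3 := H_quot_ne a p (k+1) hM (H_quot_zero a p (k+1) hd h)
    apply hp.ne_top
    rw [hK, Ideal.eq_top_iff_one, Module.mem_annihilator]
    intro y
    obtain ⟨y, rfl⟩ := Submodule.Quotient.mk_surjective _ y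
    rw [one_smul, Submodule.Quotient.mk_eq_zero]
    refine (Submodule.smul_le.2 ?_) (h3 y)
    intro r hr w _
    rw [← Submodule.Quotient.mk_eq_zero, Submodule.Quotient.mk_smul]
    rw [hK] at hr
    exact Module.mem_annihilator.1 hr _
  have h3 : ¬ DimLT R (R ⧸ p) (k+1) := fun h => h2 (H_van a _ _ h _ le_rfl)
  refine ⟨h1, h3, ?_⟩
  intro P hP haP hpP
  by_contra hne
  exact h2 (lhvt p P a hpP hne haP k hd h3)

lemma att_B (a p : Ideal R) (hp : p.IsPrime) (k : ℕ) [Module.Finite R M] (hM : DimLT R M (k+1+1)) 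
    (h1 : Module.annihilator R M ≤ p) (h2 : ¬ DimLT R (R ⧸ p) (k+1)) (ha : a ≤ maximalIdeal R)
    (h3 : ∀ P : Ideal R, P.IsPrime → a ≤ P → p ≤ P → P = maximalIdeal R) :
    ∃ K' : Submodule R (H a (k+1) M), p = Module.annihilator R (H a (k+1) M ⧸ K') := by
  let U : Submodule R M := p • ⊤
  have hkill : ∀ y : M ⧸ U, ∀ r ∈ p, r • y = 0 := by
    intro y r hr
    obtain ⟨y, rfl⟩ := Submodule.Quotient.mk_surjective _ y
    rw [← Submodule.Quotient.mk_smul, Submodule.Quotient.mk_eq_zero]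
    exact Submodule.smul_mem_smul hr trivial
  have hd := dim_quot_le p h1 hM
  have hM' : DimLT R (M ⧸ U) (k+1+1) := hM.of_surj _ U.mkQ_surjective
  have hM'2 : ¬ DimLT R (M ⧸ U) (k+1) := by
    intro h
    apply h2
    refine h.of_sub ?_
    rw [supp_quot, Module.support_quotient]
    intro q hq
    refine ⟨?_, hq⟩
    rw [Module.mem_support_iff_of_finite]
    exact h1.trans hq
  refine ⟨LinearMap.ker (Hm a (k+1) U.mkQ), ?_⟩
  have hsurj := H_rex' a U.mkQ_surjective (n := k+1) hM
  rw [((Hm a (k+1) U.mkQ).quotKerEquivOfSurjective hsurj).annihilator_eq]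
  apply le_antisymm
  · intro r hr
    rw [Module.mem_annihilator]
    intro y
    have : r • (LinearMap.id : (M ⧸ U) →ₗ[R] (M ⧸ U)) = 0 := by
      apply LinearMap.ext
      intro z
      exact hkill z r hr
    rw [← Hm_lsmul, this, Hm_zero]
  · intro c hc
    by_contra hcp
    have hcof : Cof a (maximalIdeal R) (M ⧸ U) := by
      refine pow_le_of_primes _ ?_
      intro P hP hle
      rw [h3 P hP (le_sup_left.trans hle) (le_trans ?_ (le_sup_right.trans hle))]
      intro r hr
      exact Module.mem_annihilator.2 fun y => hkill y r hr
    have hbij := chg_bij ha (k+1) (M ⧸ U) hcof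
    obtain ⟨hKf, -⟩ := K_fin_dim (R := R) (k+1) (M ⧸ U)
    have hann : ∀ r ∈ Module.annihilator R (H a (k+1) (M ⧸ U)), ∀ κ : DK R (k+1) (M ⧸ U), r • κ = 0 := by
      intro r hr κ
      ext g
      show r • κ g = 0
      rw [← map_smul]
      have : r • g = 0 := hbij.1 (by rw [map_smul, map_zero]; exact Module.mem_annihilator.1 hr _)
      rw [this, map_zero]
    refine K_ndim (k+1) (M ⧸ U) hM' hM'2 ((hd.quot (quot_reg p hcp)).of_sub ?_)
    rw [Module.support_quotSMulTop, supp_quot]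
    intro q hq
    have hq' := Module.annihilator_le_of_mem_support hq
    constructor
    · intro r hr
      refine hq' (Module.mem_annihilator.2 fun κ => ?_)
      ext g
      show r • κ g = 0
      have : r • (LinearMap.id : (M ⧸ U) →ₗ[R] (M ⧸ U)) = 0 := by
        apply LinearMap.ext
        intro z
        exact hkill z r hr
      rw [← map_smul, ← Hm_lsmul, this, Hm_zero, map_zero]
    · rw [PrimeSpectrum.mem_zeroLocus, Set.singleton_subset_iff]
      exact hq' (Module.mem_annihilator.2 (hann c hc))

end att
end LCx

namespace LCx
open Abelian IsLocalRing Pointwise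
set_option linter.unusedSectionVars false

section fin
variable {R : Type u} [CommRing R] [IsNoetherianRing R]
variable {A B C M N : Type u} [AddCommGroup A] [Module R A] [AddCommGroup B] [Module R B]
  [AddCommGroup C] [Module R C] [AddCommGroup N] [Module R N] [AddCommGroup M] [Module R M]

lemma wb_eq (s : WithBot ℕ∞) (n : ℕ) : s = ((n : ℕ) : WithBot ℕ∞) ↔ 
    s < ((n+1 : ℕ) : WithBot ℕ∞) ∧ ¬ s < (n : WithBot ℕ∞) := by
  constructor
  · rintro rfl
    exact ⟨by exact_mod_cast Nat.lt_succ_self n, lt_irrefl _⟩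
  · rintro ⟨h1, h2⟩
    refine le_antisymm ?_ (not_lt.1 h2)
    induction s using WithBot.recBotCoe with
    | bot => exact bot_le
    | coe s =>
      have h3 : s < ((n+1 : ℕ) : ℕ∞) := by exact_mod_cast h1
      have h4 : s ≤ (n : ℕ∞) := by
        push_cast at h3
        exact Order.le_of_lt_add_one h3
      exact_mod_cast h4

lemma dim_quot_iff (p : Ideal R) (n : ℕ) : ringKrullDim (R ⧸ p) = (n : WithBot (WithTop ℕ)) ↔ 
    DimLT R (R ⧸ p) (n+1) ∧ ¬ DimLT R (R ⧸ p) n := by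
  rw [← Module.supportDim_quotient_eq_ringKrullDim]
  exact wb_eq _ n

lemma dim_M [Module.Finite R M] {n : ℕ} 
    (hdim : ringKrullDim (R ⧸ Module.annihilator R M) = (n : WithBot (WithTop ℕ))) : DimLT R M (n+1) := by
  rw [← Module.supportDim_eq_ringKrullDim_quotient_annihilator] at hdim
  exact ((wb_eq _ n).1 hdim).1

lemma dim_drop (p q : Ideal R) [hq : q.IsPrime] (hqp : q ≤ p) {c : R} (hc : c ∈ p) (hcq : c ∉ q) {d : ℕ}
    (hreg : IsSMulRegular (R ⧸ q) c) (h : DimLT R (R ⧸ q) (d+1)) : DimLT R (R ⧸ p) d := by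
  refine (h.quot hreg).of_sub ?_
  rw [Module.support_quotSMulTop, supp_quot, supp_quot]
  intro P hP
  refine ⟨hqp.trans hP, ?_⟩
  rw [PrimeSpectrum.mem_zeroLocus, Set.singleton_subset_iff]
  exact hP hc

variable [IsLocalRing R] [IsAdicComplete (maximalIdeal R) R]

lemma mem_assh_iff [Module.Finite R M] {n : ℕ} (hM : DimLT R M (n+1)) (p : Ideal R) : 
    p ∈ assh R M n ↔ p.IsPrime ∧ Module.annihilator R M ≤ p ∧ ¬ DimLT R (R ⧸ p) n := by
  constructor
  · rintro ⟨h1, h2⟩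
    exact ⟨h1.isPrime, (by have h0 := h1.annihilator_le; rwa [Submodule.annihilator_top] at h0), ((dim_quot_iff p n).1 h2).2⟩
  · rintro ⟨hp, h1, h2⟩
    refine ⟨?_, (dim_quot_iff p n).2 ⟨dim_quot_le p h1 hM, h2⟩⟩
    apply Module.associatedPrimes.minimalPrimes_annihilator_subset_associatedPrimes
    refine ⟨⟨hp, h1⟩, ?_⟩
    rintro q ⟨hq, hqA⟩ hqp c hc
    by_contra hcq
    exact h2 (dim_drop p q hqp hc hcq (quot_reg q hcq) (dim_quot_le q hqA hM))

lemma not_dimLT_one (Q : Ideal R) [hQ : Q.IsPrime] (h : Q ≠ maximalIdeal R) : ¬ DimLT R (R ⧸ Q) 1 := by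
  intro h1
  have hm : ¬ maximalIdeal R ≤ Q := fun h' => h ((maximalIdeal.isMaximal R).eq_of_le hQ.ne_top h').symm
  exact one_ne_zero (Gam_quot_prime Q hm 1 (tors_of_dimLT_one h1 1))

lemma dim_one_of_max (Q : Ideal R) [hQ : Q.IsPrime] (h : Q ≠ maximalIdeal R) 
    (hmax : ∀ P : Ideal R, P.IsPrime → Q ≤ P → P = Q ∨ P = maximalIdeal R) : 
    ringKrullDim (R ⧸ Q) = (1 : WithBot (WithTop ℕ)) := by
  have hm : ¬ maximalIdeal R ≤ Q := fun h' => h ((maximalIdeal.isMaximal R).eq_of_le hQ.ne_top h').symm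
  obtain ⟨c, hc, hcQ⟩ := SetLike.not_le_iff_exists.1 hm
  refine (dim_quot_iff Q 1).2 ⟨DimLT.of_quot hc ?_, not_dimLT_one Q h⟩
  obtain ⟨s, hs⟩ := pow_le_of_primes (m := maximalIdeal R) (Module.annihilator R (QuotSMulTop c (R ⧸ Q))) (by
    intro P hP hle
    have hP' : (⟨P, hP⟩ : PrimeSpectrum R) ∈ Module.support R (QuotSMulTop c (R ⧸ Q)) := by
      rw [Module.mem_support_iff_of_finite]; exact hle
    rw [Module.support_quotSMulTop, supp_quot] at hP'
    rcases hmax P hP hP'.1 with rfl | rfl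
    · exact absurd (hP'.2 rfl) hcQ
    · exact le_rfl)
  exact dimLT_one_of_pow (s := s) fun r hr y => Module.mem_annihilator.1 (hs hr) y

lemma max_of_dim_one (Q : Ideal R) [hQ : Q.IsPrime] (h : ringKrullDim (R ⧸ Q) = (1 : WithBot (WithTop ℕ))) 
    (P : Ideal R) (hP : P.IsPrime) (hQP : Q ≤ P) : P = Q ∨ P = maximalIdeal R := by
  by_contra hc
  push Not at hc
  obtain ⟨c, hcP, hcQ⟩ := SetLike.not_le_iff_exists.1 (fun h' => hc.1 (le_antisymm h' hQP))
  exact not_dimLT_one P hc.2 (dim_drop P Q hQP hcP hcQ (quot_reg Q hcQ) ((dim_quot_iff Q 1).1 h).1)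

lemma ne_max_of_dim_one (Q : Ideal R) (h : ringKrullDim (R ⧸ Q) = (1 : WithBot (WithTop ℕ))) : 
    Q ≠ maximalIdeal R := by
  rintro rfl
  refine ((dim_quot_iff _ 1).1 h).2 (dimLT_one_of_pow (s := 1) ?_)
  intro r hr y
  rw [pow_one] at hr
  obtain ⟨y, rfl⟩ := Ideal.Quotient.mk_surjective y
  exact Ideal.Quotient.eq_zero_iff_mem.2 (Ideal.mul_mem_right _ _ hr)

lemma att_congr (e : A ≃ₗ[R] B) {p : Ideal R} (h : ∃ K : Submodule R A, p = Module.annihilator R (A ⧸ K)) :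
    ∃ K : Submodule R B, p = Module.annihilator R (B ⧸ K) := by
  obtain ⟨K, rfl⟩ := h
  exact ⟨K.map (e : A →ₗ[R] B), (Submodule.Quotient.equiv K _ e rfl).annihilator_eq⟩

lemma att_top (k : ℕ) : attachedPrimes R ((localCohomology (⊤ : Ideal R) (k+1)).obj (ModuleCat.of R M)) = ∅ := by
  rw [Set.eq_empty_iff_forall_notMem]
  rintro p ⟨hp, K, hK⟩
  apply hp.ne_top
  rw [hK, Ideal.eq_top_iff_one, Module.mem_annihilator]
  intro y
  obtain ⟨y, rfl⟩ := Submodule.Quotient.mk_surjective _ y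
  have : y = 0 := (lcEquiv (⊤ : Ideal R) k (ModuleCat.of R M)).injective (by rw [map_zero]; exact H_top _ _ _)
  rw [this, Submodule.Quotient.mk_zero, smul_zero]

lemma att_iff (a : Ideal R) (ha : a ≤ maximalIdeal R) (k : ℕ) [Module.Finite R M] (hM : DimLT R M (k+1+1)) (p : Ideal R) :
    p ∈ attachedPrimes R ((localCohomology a (k+1)).obj (ModuleCat.of R M)) ↔ 
      p ∈ assh R M (k+1) ∧ ∀ P : Ideal R, P.IsPrime → a ≤ P → p ≤ P → P = maximalIdeal R := by
  rw [mem_assh_iff hM]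
  constructor
  · rintro ⟨hp, h⟩
    obtain ⟨K, hK⟩ := att_congr (lcEquiv a k (ModuleCat.of R M)) h
    obtain ⟨h1, h2, h3⟩ := att_A a p hp k hM K hK
    exact ⟨⟨hp, h1, h2⟩, h3⟩
  · rintro ⟨⟨hp, h1, h2⟩, h3⟩
    exact ⟨hp, att_congr (lcEquiv a k (ModuleCat.of R M)).symm (att_B a p hp k hM h1 h2 ha h3)⟩

end fin
end LCx

theorem stmt1 (R : Type u) [CommRing R] [IsNoetherianRing R] [IsLocalRing R]
    [IsAdicComplete (IsLocalRing.maximalIdeal R) R]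
    (M : Type u) [AddCommGroup M] [Module R M] [Module.Finite R M]
    (n : ℕ) (hn : 1 ≤ n)
    (hdim : ringKrullDim (R ⧸ Module.annihilator R M) = (n : WithBot (WithTop ℕ)))
    (T : Set (Ideal R)) (hT : T ⊆ assh R M n) (hTne : T.Nonempty)
    (hTproper : T ≠ assh R M n) :
    (∃ a : Ideal R,
        attachedPrimes R ((localCohomology a n).obj (ModuleCat.of R M)) = T) ↔
      ∀ q ∈ assh R M n \ T, ∃ Q : PrimeSpectrum R, Q ∈ Module.support R M ∧
        ringKrullDim (R ⧸ Q.asIdeal) = (1 : WithBot (WithTop ℕ)) ∧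
        ¬ sInf T ≤ Q.asIdeal ∧ q ≤ Q.asIdeal := by
  obtain ⟨k, rfl⟩ : ∃ k, n = k + 1 := ⟨n - 1, by omega⟩
  have hM : LCx.DimLT R M (k+1+1) := LCx.dim_M hdim
  have hTfin : T.Finite := (associatedPrimes.finite R M).subset (fun p hp => (hT hp).1)
  constructor
  · rintro ⟨a, ha⟩ q ⟨hq, hqT⟩
    have ham : a ≤ IsLocalRing.maximalIdeal R := by
      apply IsLocalRing.le_maximalIdeal
      rintro rfl
      rw [LCx.att_top] at ha
      exact hTne.ne_empty ha.symm
    have hqp := hq.1.isPrime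
    let S : Set (Ideal R) := {P | P.IsPrime ∧ a ≤ P ∧ q ≤ P ∧ P ≠ IsLocalRing.maximalIdeal R}
    have hS : S.Nonempty := by
      by_contra hne
      apply hqT
      rw [← ha, LCx.att_iff a ham k hM]
      refine ⟨hq, fun P hP h1 h2 => ?_⟩
      by_contra h3
      exact hne ⟨P, hP, h1, h2, h3⟩
    obtain ⟨Q, ⟨hQ, haQ, hqQ, hQm⟩, hmax⟩ := set_has_maximal_iff_noetherian.2 ‹IsNoetherianRing R› S hS
    refine ⟨⟨Q, hQ⟩, ?_, ?_, ?_, hqQ⟩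
    · rw [Module.mem_support_iff_of_finite]
      exact (by have h0 := hq.1.annihilator_le; rw [Submodule.annihilator_top] at h0; exact h0.trans hqQ)
    · refine LCx.dim_one_of_max Q hQm ?_
      intro P hP hQP
      by_contra hc
      push Not at hc
      exact hmax P ⟨hP, haQ.trans hQP, hqQ.trans hQP, hc.2⟩ (lt_of_le_of_ne hQP (Ne.symm hc.1))
    · intro hle
      have h1 : hTfin.toFinset.inf id ≤ Q := by
        refine le_trans (le_sInf fun p hp => ?_) hle
        exact Finset.inf_le (f := id) (hTfin.mem_toFinset.2 hp)
      obtain ⟨p, hp, hpQ⟩ := hQ.inf_le'.1 h1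
      have hpT := hTfin.mem_toFinset.1 hp
      rw [← ha, LCx.att_iff a ham k hM] at hpT
      exact hQm (hpT.2 Q hQ haQ hpQ)
  · intro h
    choose! F hF using h
    have hfin : (assh R M (k+1) \ T).Finite := 
      (associatedPrimes.finite R M).subset (fun p hp => hp.1.1)
    let a : Ideal R := hfin.toFinset.inf (fun q => (F q).asIdeal)
    have haF : ∀ q ∈ assh R M (k+1) \ T, a ≤ (F q).asIdeal := fun q hq =>
      Finset.inf_le (f := fun q => (F q).asIdeal) (hfin.mem_toFinset.2 hq)
    have ham : a ≤ IsLocalRing.maximalIdeal R := by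
      obtain ⟨q, hq⟩ : (assh R M (k+1) \ T).Nonempty := by
        rw [Set.nonempty_iff_ne_empty, Ne, Set.diff_eq_empty]
        exact fun hle => hTproper (Set.Subset.antisymm hT hle)
      exact (haF q hq).trans (IsLocalRing.le_maximalIdeal (F q).2.ne_top)
    refine ⟨a, ?_⟩
    ext p
    rw [LCx.att_iff a ham k hM]
    constructor
    · rintro ⟨hp, hP⟩
      by_contra hpT
      obtain ⟨-, h2, -, h4⟩ := hF p ⟨hp, hpT⟩
      exact LCx.ne_max_of_dim_one _ h2 (hP _ (F p).2 (haF p ⟨hp, hpT⟩) h4)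
    · intro hp
      refine ⟨hT hp, ?_⟩
      intro P hP haP hpP
      obtain ⟨q, hq, hqP⟩ := hP.inf_le'.1 haP
      obtain ⟨-, h2, h3, -⟩ := hF q (hfin.mem_toFinset.1 hq)
      have := (F q).2
      rcases LCx.max_of_dim_one _ h2 P hP hqP with rfl | h
      · exact absurd ((sInf_le hp).trans hpP) h3
      · exact h

end
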